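/- Let F̄(x) = e^{−R(x)}, where R is regularly varying at infinity with index β ∈ (0,1), and assume F is strong subexponential (F ∈ S*). Then, for every ε > 0, (1+o(1))·F̄((m+ε)x) ≤ P{W_n > x} ≤ (1+o(1))·F̄((m−ε)x) as x → ∞, uniformly in n ≥ 1. -/

import Mathlib

open MeasureTheory Filter ProbabilityTheory

lemma gw_exp_bound (u : ℝ) : Real.exp u ≤ 1 + u + u ^ 2 * Real.exp (max u 0) := by
  rcases le_total 0 u with h | h
  · rw [max_eq_left h]
    have h1 : 1 - u ≤ Real.exp (-u) := by linarith [Real.add_one_le_exp (-u)]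
    have h2 : Real.exp u * Real.exp (-u) = 1 := by rw [← Real.exp_add]; simp
    have h3 : Real.exp u * (1 - u) ≤ 1 := by
      exact (mul_le_mul_of_nonneg_left h1 (Real.exp_pos _).le).trans h2.le
    nlinarith [mul_le_mul_of_nonneg_left h3 h]
  · rw [max_eq_right h]
    have h1 : 1 - u ≤ Real.exp (-u) := by linarith [Real.add_one_le_exp (-u)]
    have h2 : Real.exp u * Real.exp (-u) = 1 := by rw [← Real.exp_add]; simp
    have h3 : Real.exp u * (1 - u) ≤ 1 := by
      exact (mul_le_mul_of_nonneg_left h1 (Real.exp_pos _).le).trans h2.le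
    simp only [Real.exp_zero, mul_one]
    by_contra hc
    push Not at hc
    have : (1 + u + u ^ 2) * (1 - u) < 1 :=
      lt_of_lt_of_le (mul_lt_mul_of_pos_right hc (by linarith)) h3
    nlinarith [pow_nonneg (neg_nonneg.2 h) 3]

lemma gw_single_core (ν : Measure ℕ) [IsProbabilityMeasure ν] (m : ℝ) (u g : ℕ → ℝ) (D K : ℝ)
    (hu : Integrable u ν) (hu0 : ∫ j, u j ∂ν ≤ 0) (hub : ∀ j, |u j| ≤ D * |(j : ℝ) - m|)
    (hug : ∀ j, u j ≤ g j) (hg : ∀ j, 0 ≤ g j)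
    (hK : Integrable (fun j : ℕ => ((j : ℝ) - m) ^ 2 * Real.exp (g j)) ν)
    (hKv : ∫ j, ((j : ℝ) - m) ^ 2 * Real.exp (g j) ∂ν ≤ K) :
    ∫⁻ j, ENNReal.ofReal (Real.exp (u j)) ∂ν ≤ ENNReal.ofReal (Real.exp (K * D ^ 2)) := by
  have hpt : ∀ j : ℕ, Real.exp (u j) ≤ 1 + u j + D ^ 2 * (((j : ℝ) - m) ^ 2 * Real.exp (g j)) := by
    intro j
    have h1 := gw_exp_bound (u j)
    have h2 : u j ^ 2 ≤ D ^ 2 * ((j : ℝ) - m) ^ 2 := by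
      rw [← sq_abs (u j), ← sq_abs ((j : ℝ) - m), ← mul_pow]
      exact pow_le_pow_left₀ (abs_nonneg _) (hub j) 2
    have h3 : Real.exp (max (u j) 0) ≤ Real.exp (g j) :=
      Real.exp_le_exp.2 (max_le (hug j) (hg j))
    have h4 : u j ^ 2 * Real.exp (max (u j) 0) ≤ D ^ 2 * ((j : ℝ) - m) ^ 2 * Real.exp (g j) :=
      mul_le_mul h2 h3 (Real.exp_pos _).le (by positivity)
    linarith
  have hint : Integrable (fun j : ℕ => 1 + u j + D ^ 2 * (((j : ℝ) - m) ^ 2 * Real.exp (g j))) ν :=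
    ((integrable_const 1).add hu).add (hK.const_mul _)
  have hval : ∫ j, (1 + u j + D ^ 2 * (((j : ℝ) - m) ^ 2 * Real.exp (g j))) ∂ν
      ≤ Real.exp (K * D ^ 2) := by
    have hi1 : Integrable (fun j : ℕ => 1 + u j) ν := (integrable_const (1:ℝ)).add hu
    rw [integral_add hi1 (hK.const_mul _),
      integral_add (integrable_const 1) hu, integral_const_mul]
    simp only [integral_const, probReal_univ, smul_eq_mul, mul_one]
    have := Real.add_one_le_exp (K * D ^ 2)
    nlinarith [mul_le_mul_of_nonneg_left hKv (sq_nonneg D)]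
  calc ∫⁻ j, ENNReal.ofReal (Real.exp (u j)) ∂ν
      ≤ ∫⁻ j, ENNReal.ofReal (1 + u j + D ^ 2 * (((j : ℝ) - m) ^ 2 * Real.exp (g j))) ∂ν :=
        lintegral_mono fun j => ENNReal.ofReal_le_ofReal (hpt j)
    _ = ENNReal.ofReal (∫ j, (1 + u j + D ^ 2 * (((j : ℝ) - m) ^ 2 * Real.exp (g j))) ∂ν) := by
        rw [ofReal_integral_eq_lintegral_ofReal hint]
        exact Eventually.of_forall fun j => (Real.exp_pos _).le.trans (hpt j)
    _ ≤ _ := ENNReal.ofReal_le_ofReal hval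

/-- expectation of `f (S_k)` for `S_k` the sum of `k` iid variables with law `ν`. -/
noncomputable def gwI (ν : Measure ℕ) : ℕ → (ℕ → ENNReal) → ENNReal
  | 0, f => f 0
  | k + 1, f => ∫⁻ j, gwI ν k (fun i => f (j + i)) ∂ν

lemma gw_laplace_single (ν : Measure ℕ) [IsProbabilityMeasure ν] (m : ℝ) (hm0 : 0 ≤ m)
    (hν : Integrable (fun j : ℕ => (j : ℝ)) ν) (hm : m = ∫ j, (j : ℝ) ∂ν)
    (V : ℝ) (hV : Integrable (fun j : ℕ => ((j : ℝ) - m) ^ 2) ν)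
    (hVv : ∫ j, ((j : ℝ) - m) ^ 2 ∂ν ≤ V) (s : ℝ) (hs0 : 0 ≤ s) (hs1 : s ≤ 1) :
    ∫⁻ j, ENNReal.ofReal (Real.exp (-(s * (j : ℝ)))) ∂ν
      ≤ ENNReal.ofReal (Real.exp (-(s * m) + (V * Real.exp m) * s ^ 2)) := by
  have h := gw_single_core ν m (fun j : ℕ => -(s * ((j : ℝ) - m))) (fun _ => m) s (V * Real.exp m)
    (((hν.sub (integrable_const m)).const_mul s).neg)
    (by
      rw [integral_neg, integral_const_mul, integral_sub hν (integrable_const m), ← hm]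
      simp)
    (by intro j; rw [abs_neg, abs_mul, abs_of_nonneg hs0])
    (by
      intro j
      have : (0:ℝ) ≤ j := Nat.cast_nonneg j
      nlinarith [mul_nonneg hs0 this])
    (fun _ => hm0) (hV.mul_const _)
    (by
      rw [integral_mul_const]
      exact mul_le_mul_of_nonneg_right hVv (Real.exp_pos _).le)
  calc ∫⁻ j, ENNReal.ofReal (Real.exp (-(s * (j : ℝ)))) ∂ν
      = ∫⁻ j : ℕ, ENNReal.ofReal (Real.exp (-(s * m))) *
          ENNReal.ofReal (Real.exp (-(s * ((j : ℝ) - m)))) ∂ν := by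
        refine lintegral_congr fun j => ?_
        rw [← ENNReal.ofReal_mul (Real.exp_pos _).le, ← Real.exp_add]
        congr 2; ring
    _ = ENNReal.ofReal (Real.exp (-(s * m))) *
          ∫⁻ j : ℕ, ENNReal.ofReal (Real.exp (-(s * ((j : ℝ) - m)))) ∂ν :=
        lintegral_const_mul _ (Measurable.of_discrete)
    _ ≤ ENNReal.ofReal (Real.exp (-(s * m))) * ENNReal.ofReal (Real.exp (V * Real.exp m * s ^ 2)) :=
        mul_le_mul_right h _
    _ = _ := by rw [← ENNReal.ofReal_mul (Real.exp_pos _).le, ← Real.exp_add]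

lemma gw_laplace (ν : Measure ℕ) [IsProbabilityMeasure ν] (s c : ℝ)
    (h : ∫⁻ j, ENNReal.ofReal (Real.exp (-(s * (j : ℝ)))) ∂ν ≤ ENNReal.ofReal (Real.exp (-c)))
    (k : ℕ) : ∀ b : ℝ,
    gwI ν k (fun j => ENNReal.ofReal (Real.exp (b - s * (j : ℝ))))
      ≤ ENNReal.ofReal (Real.exp (b - c * k)) := by
  induction k with
  | zero => intro b; simp [gwI]
  | succ k ih =>
    intro b
    simp only [gwI]
    calc ∫⁻ j : ℕ, gwI ν k (fun i => ENNReal.ofReal (Real.exp (b - s * ((j + i : ℕ) : ℝ)))) ∂ν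
        ≤ ∫⁻ j : ℕ, ENNReal.ofReal (Real.exp (b - c * k)) *
            ENNReal.ofReal (Real.exp (-(s * (j : ℝ)))) ∂ν := by
          refine lintegral_mono fun j => ?_
          have := ih (b - s * j)
          rw [← ENNReal.ofReal_mul (Real.exp_pos _).le, ← Real.exp_add]
          convert this using 4
          · push_cast; ring_nf
          · ring
      _ = ENNReal.ofReal (Real.exp (b - c * k)) *
            ∫⁻ j : ℕ, ENNReal.ofReal (Real.exp (-(s * (j : ℝ)))) ∂ν :=
          lintegral_const_mul _ (Measurable.of_discrete)
      _ ≤ ENNReal.ofReal (Real.exp (b - c * k)) * ENNReal.ofReal (Real.exp (-c)) :=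
          mul_le_mul_right h _
      _ = _ := by
          rw [← ENNReal.ofReal_mul (Real.exp_pos _).le, ← Real.exp_add]
          congr 2; push_cast; ring

lemma gw_phi_single (ν : Measure ℕ) [IsProbabilityMeasure ν] (m : ℝ) (hm0 : 0 ≤ m)
    (hν : Integrable (fun j : ℕ => (j : ℝ)) ν) (hm : m = ∫ j, (j : ℝ) ∂ν)
    (φ : ℝ → ℝ) (hc : ConcaveOn ℝ (Set.Ici 0) φ) (hcont : ContinuousOn φ (Set.Ici 0))
    (hmono : MonotoneOn φ (Set.Ici 0)) (hsub : ∀ x y, 0 ≤ x → 0 ≤ y → φ (x + y) ≤ φ x + φ y)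
    (hφ0 : φ 0 = 0)
    (K : ℝ) (hK : Integrable (fun j : ℕ => ((j : ℝ) - m) ^ 2 * Real.exp (φ |(j : ℝ) - m|)) ν)
    (hKv : ∫ j, ((j : ℝ) - m) ^ 2 * Real.exp (φ |(j : ℝ) - m|) ∂ν ≤ K)
    (s a d : ℝ) (hs : 0 ≤ s) (ha0 : 0 ≤ a) (ha1 : a ≤ 1)
    (hd : ∀ v h, s ≤ v → 0 ≤ h → φ (v + h) - φ v ≤ d * h) :
    ∫⁻ j, ENNReal.ofReal (Real.exp (φ (s + a * (j : ℝ)))) ∂ν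
      ≤ ENNReal.ofReal (Real.exp (φ (s + a * m) + K * a ^ 2 * d ^ 2)) := by
  have hpos : ∀ x, 0 ≤ x → 0 ≤ φ x := fun x hx => by
    rw [← hφ0]; exact hmono (Set.mem_Ici.2 le_rfl) hx hx
  have hj : ∀ j : ℕ, (0:ℝ) ≤ a * j := fun j => mul_nonneg ha0 (Nat.cast_nonneg j)
  have ham : 0 ≤ a * m := mul_nonneg ha0 hm0
  have hub : ∀ j : ℕ, |φ (s + a * (j : ℝ)) - φ (s + a * m)| ≤ (a * d) * |(j : ℝ) - m| := by
    intro j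
    rcases le_total m (j : ℝ) with h | h
    · have h1 := hd (s + a * m) (a * (j - m)) (by linarith) (mul_nonneg ha0 (by linarith))
      have h2 : φ (s + a * m) ≤ φ (s + a * j) :=
        hmono (Set.mem_Ici.2 (by linarith)) (Set.mem_Ici.2 (by linarith [hj j]))
          (by nlinarith [mul_le_mul_of_nonneg_left h ha0])
      rw [abs_of_nonneg (by linarith), abs_of_nonneg (by linarith)]
      have e : s + a * m + a * (j - m) = s + a * j := by ring
      rw [e] at h1; linarith
    · have h1 := hd (s + a * j) (a * (m - j)) (by linarith [hj j]) (mul_nonneg ha0 (by linarith))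
      have h2 : φ (s + a * j) ≤ φ (s + a * m) :=
        hmono (Set.mem_Ici.2 (by linarith [hj j])) (Set.mem_Ici.2 (by linarith))
          (by nlinarith [mul_le_mul_of_nonneg_left h ha0])
      rw [abs_of_nonpos (by linarith), abs_of_nonpos (by linarith)]
      have e : s + a * j + a * (m - j) = s + a * m := by ring
      rw [e] at h1; linarith
  have hu : Integrable (fun j : ℕ => φ (s + a * (j : ℝ)) - φ (s + a * m)) ν := by
    refine Integrable.mono' (((hν.sub (integrable_const m)).abs).const_mul (a * d))
      (Measurable.of_discrete).aestronglyMeasurable ?_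
    exact Eventually.of_forall fun j => by simpa using hub j
  have hu' : Integrable (fun j : ℕ => φ (s + a * (j : ℝ))) ν := by
    have := hu.add (integrable_const (φ (s + a * m)))
    refine this.congr (Eventually.of_forall fun j => ?_)
    simp
  have hlin : Integrable (fun j : ℕ => s + a * (j : ℝ)) ν :=
    (integrable_const s).add (hν.const_mul a)
  have hjen := hc.le_map_integral hcont isClosed_Ici
    (Eventually.of_forall fun j : ℕ => Set.mem_Ici.2 (by linarith [hj j])) hlin hu'
  have hlv : ∫ j : ℕ, (s + a * (j : ℝ)) ∂ν = s + a * m := by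
    rw [integral_add (integrable_const s) (hν.const_mul a), integral_const_mul, ← hm]
    simp
  rw [hlv] at hjen
  have h := gw_single_core ν m (fun j : ℕ => φ (s + a * (j : ℝ)) - φ (s + a * m))
    (fun j => φ |(j : ℝ) - m|) (a * d) K hu
    (by rw [integral_sub hu' (integrable_const _)]; simpa using hjen) hub
    (by
      intro j
      rcases le_total m (j : ℝ) with h | h
      · have h1 := hsub (s + a * m) (a * (j - m)) (by linarith) (mul_nonneg ha0 (by linarith))
        have e : s + a * m + a * (j - m) = s + a * j := by ring
        rw [e] at h1
        have h3 : a * (j - m) ≤ j - m := by nlinarith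
        have h4 : φ (a * (j - m)) ≤ φ (j - m) :=
          hmono (Set.mem_Ici.2 (mul_nonneg ha0 (by linarith))) (Set.mem_Ici.2 (by linarith)) h3
        rw [abs_of_nonneg (by linarith)]; linarith
      · have h2 : φ (s + a * j) ≤ φ (s + a * m) :=
          hmono (Set.mem_Ici.2 (by linarith [hj j])) (Set.mem_Ici.2 (by linarith))
            (by nlinarith [mul_le_mul_of_nonneg_left h ha0])
        have := hpos _ (abs_nonneg ((j:ℝ) - m))
        linarith)
    (fun j => hpos _ (abs_nonneg _)) hK hKv
  calc ∫⁻ j, ENNReal.ofReal (Real.exp (φ (s + a * (j : ℝ)))) ∂ν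
      = ∫⁻ j : ℕ, ENNReal.ofReal (Real.exp (φ (s + a * m))) *
          ENNReal.ofReal (Real.exp (φ (s + a * (j : ℝ)) - φ (s + a * m))) ∂ν := by
        refine lintegral_congr fun j => ?_
        rw [← ENNReal.ofReal_mul (Real.exp_pos _).le, ← Real.exp_add]
        congr 2; ring
    _ = ENNReal.ofReal (Real.exp (φ (s + a * m))) *
          ∫⁻ j : ℕ, ENNReal.ofReal (Real.exp (φ (s + a * (j : ℝ)) - φ (s + a * m))) ∂ν :=
        lintegral_const_mul _ (Measurable.of_discrete)
    _ ≤ ENNReal.ofReal (Real.exp (φ (s + a * m))) *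
          ENNReal.ofReal (Real.exp (K * (a * d) ^ 2)) := mul_le_mul_right h _
    _ = _ := by
        rw [← ENNReal.ofReal_mul (Real.exp_pos _).le, ← Real.exp_add]
        congr 2; ring

lemma gw_phi_sum (ν : Measure ℕ) [IsProbabilityMeasure ν] (m : ℝ) (hm0 : 0 ≤ m)
    (hν : Integrable (fun j : ℕ => (j : ℝ)) ν) (hm : m = ∫ j, (j : ℝ) ∂ν)
    (φ : ℝ → ℝ) (hc : ConcaveOn ℝ (Set.Ici 0) φ) (hcont : ContinuousOn φ (Set.Ici 0))
    (hmono : MonotoneOn φ (Set.Ici 0)) (hsub : ∀ x y, 0 ≤ x → 0 ≤ y → φ (x + y) ≤ φ x + φ y)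
    (hφ0 : φ 0 = 0)
    (K : ℝ) (hK : Integrable (fun j : ℕ => ((j : ℝ) - m) ^ 2 * Real.exp (φ |(j : ℝ) - m|)) ν)
    (hKv : ∫ j, ((j : ℝ) - m) ^ 2 * Real.exp (φ |(j : ℝ) - m|) ∂ν ≤ K)
    (a : ℝ) (ha0 : 0 ≤ a) (ha1 : a ≤ 1) (D : ℕ → ℝ) (k : ℕ) :
    ∀ s, 0 ≤ s → (∀ i : ℕ, ∀ v h, s + i * (a * m) ≤ v → 0 ≤ h → φ (v + h) - φ v ≤ D i * h) →
    gwI ν k (fun j => ENNReal.ofReal (Real.exp (φ (s + a * (j : ℝ)))))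
      ≤ ENNReal.ofReal (Real.exp (φ (s + k * (a * m)) +
          K * a ^ 2 * ∑ i ∈ Finset.range k, D i ^ 2)) := by
  induction k with
  | zero => intro s hs hD; simp [gwI]
  | succ k ih =>
    intro s hs hD
    have ham : 0 ≤ a * m := mul_nonneg ha0 hm0
    have hkam : 0 ≤ k * (a * m) := mul_nonneg (Nat.cast_nonneg k) ham
    have h1 := gw_phi_single ν m hm0 hν hm φ hc hcont hmono hsub hφ0 K hK hKv
      (s + k * (a * m)) a (D k) (by linarith) ha0 ha1 (hD k)
    simp only [gwI]
    calc ∫⁻ j : ℕ, gwI ν k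
            (fun i => ENNReal.ofReal (Real.exp (φ (s + a * ((j + i : ℕ) : ℝ))))) ∂ν
        ≤ ∫⁻ j : ℕ, ENNReal.ofReal (Real.exp (K * a ^ 2 * ∑ i ∈ Finset.range k, D i ^ 2)) *
            ENNReal.ofReal (Real.exp (φ (s + k * (a * m) + a * (j : ℝ)))) ∂ν := by
          refine lintegral_mono fun j => ?_
          have hj : (0:ℝ) ≤ a * j := mul_nonneg ha0 (Nat.cast_nonneg j)
          have := ih (s + a * j) (by linarith)
            (fun i v h hv hh => hD i v h (by linarith) hh)
          rw [← ENNReal.ofReal_mul (Real.exp_pos _).le, ← Real.exp_add]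
          have e1 : s + a * (j:ℝ) + k * (a * m) = s + k * (a * m) + a * j := by ring
          rw [e1, add_comm (φ _)] at this
          convert this using 5
          push_cast; ring_nf
      _ = ENNReal.ofReal (Real.exp (K * a ^ 2 * ∑ i ∈ Finset.range k, D i ^ 2)) *
            ∫⁻ j : ℕ, ENNReal.ofReal (Real.exp (φ (s + k * (a * m) + a * (j : ℝ)))) ∂ν :=
          lintegral_const_mul _ (Measurable.of_discrete)
      _ ≤ ENNReal.ofReal (Real.exp (K * a ^ 2 * ∑ i ∈ Finset.range k, D i ^ 2)) * _ :=
          mul_le_mul_right h1 _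
      _ = _ := by
          rw [← ENNReal.ofReal_mul (Real.exp_pos _).le, ← Real.exp_add, Finset.sum_range_succ]
          congr 2
          have e : s + k * (a * m) + a * m = s + (k + 1 : ℕ) * (a * m) := by push_cast; ring
          rw [e]; ring

lemma gw_phi_sum' (ν : Measure ℕ) [IsProbabilityMeasure ν] (m : ℝ) (hm0 : 1 ≤ m)
    (hν : Integrable (fun j : ℕ => (j : ℝ)) ν) (hm : m = ∫ j, (j : ℝ) ∂ν)
    (φ : ℝ → ℝ) (hc : ConcaveOn ℝ (Set.Ici 0) φ) (hcont : ContinuousOn φ (Set.Ici 0))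
    (hmono : MonotoneOn φ (Set.Ici 0)) (hsub : ∀ x y, 0 ≤ x → 0 ≤ y → φ (x + y) ≤ φ x + φ y)
    (hslope : ∀ w' w v h, 0 ≤ w' → w' < w → w ≤ v → 0 ≤ h →
      φ (v + h) - φ v ≤ (φ w - φ w') / (w - w') * h)
    (hφ0 : φ 0 = 0) (L : ℝ) (hL0 : 0 ≤ L)
    (hL : ∀ v h, 0 ≤ v → 0 ≤ h → φ (v + h) - φ v ≤ L * h)
    (K : ℝ) (hK0 : 0 ≤ K)
    (hK : Integrable (fun j : ℕ => ((j : ℝ) - m) ^ 2 * Real.exp (φ |(j : ℝ) - m|)) ν)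
    (hKv : ∫ j, ((j : ℝ) - m) ^ 2 * Real.exp (φ |(j : ℝ) - m|) ∂ν ≤ K)
    (a : ℝ) (ha0 : 0 < a) (ha1 : a ≤ 1) (k : ℕ) :
    gwI ν k (fun j => ENNReal.ofReal (Real.exp (φ (a * (j : ℝ)))))
      ≤ ENNReal.ofReal (Real.exp (φ (a * m * k) * (1 + K * L * a) + K * L ^ 2 * a)) := by
  have ham : 0 < a * m := mul_pos ha0 (by linarith)
  have hpos : ∀ x, 0 ≤ x → 0 ≤ φ x := fun x hx => by
    rw [← hφ0]; exact hmono (Set.mem_Ici.2 le_rfl) hx hx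
  set D : ℕ → ℝ := fun i => if i = 0 then L else
    (φ (i * (a * m)) - φ ((i - 1 : ℝ) * (a * m))) / (a * m) with hD
  have h := gw_phi_sum ν m (by linarith) hν hm φ hc hcont hmono hsub hφ0 K hK hKv a ha0.le ha1 D k
    0 le_rfl (by
      intro i v h hv hh
      rcases Nat.eq_zero_or_pos i with rfl | hi
      · simpa [hD] using hL v h (by simpa using hv) hh
      · simp only [hD, hi.ne', if_false]
        have hi1 : (1:ℝ) ≤ i := by exact_mod_cast hi
        have := hslope ((i - 1 : ℝ) * (a * m)) (i * (a * m)) v h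
          (mul_nonneg (by linarith) ham.le) (by nlinarith) (by linarith) hh
        have e : (i : ℝ) * (a * m) - (i - 1 : ℝ) * (a * m) = a * m := by ring
        rwa [e] at this)
  have hsum : ∀ k : ℕ, ∑ i ∈ Finset.range k, D i ^ 2 ≤ L ^ 2 + L * φ (k * (a * m)) / (a * m) := by
    intro k
    rcases Nat.eq_zero_or_pos k with rfl | hk
    · simp [hφ0]; positivity
    · obtain ⟨k, rfl⟩ := Nat.exists_eq_succ_of_ne_zero hk.ne'
      have : ∑ i ∈ Finset.range (k + 1), D i ^ 2 ≤ L ^ 2 + L * φ (k * (a * m)) / (a * m) := by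
        clear hk h
        induction k with
        | zero => simp [hD, hφ0]
        | succ k ih =>
          rw [Finset.sum_range_succ]
          have hk0 : (0:ℝ) ≤ k * (a * m) := mul_nonneg (Nat.cast_nonneg k) ham.le
          have e0 : ((k + 1 : ℕ) : ℝ) * (a * m) = k * (a * m) + a * m := by push_cast; ring
          have e : D (k + 1) = (φ ((k + 1 : ℕ) * (a * m)) - φ (k * (a * m))) / (a * m) := by
            simp [hD]
          have h0 : 0 ≤ D (k + 1) := by
            rw [e]; refine div_nonneg (sub_nonneg.2 ?_) ham.le
            exact hmono (Set.mem_Ici.2 hk0) (Set.mem_Ici.2 (by linarith)) (by linarith)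
          have h1 : D (k + 1) ≤ L := by
            rw [e, div_le_iff₀ ham, e0]; exact hL _ _ hk0 ham.le
          have h2 : D (k + 1) ^ 2 ≤ L * D (k + 1) := by nlinarith
          have h3 : L * φ (k * (a * m)) / (a * m) + L * D (k + 1)
              = L * φ ((k + 1 : ℕ) * (a * m)) / (a * m) := by
            rw [e]; ring
          linarith
      refine this.trans ?_
      have hk0 : (0:ℝ) ≤ k * (a * m) := mul_nonneg (Nat.cast_nonneg k) ham.le
      have e0 : ((k + 1 : ℕ) : ℝ) * (a * m) = k * (a * m) + a * m := by push_cast; ring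
      have := hmono (Set.mem_Ici.2 hk0) (Set.mem_Ici.2 (by linarith : 0 ≤ k * (a * m) + a * m))
        (by linarith)
      show _ ≤ L ^ 2 + L * φ ((k + 1 : ℕ) * (a * m)) / (a * m)
      rw [e0]; gcongr
  simp only [zero_add] at h
  refine h.trans (ENNReal.ofReal_le_ofReal (Real.exp_le_exp.2 ?_))
  have ek : (k:ℝ) * (a * m) = a * m * k := by ring
  have h1 := hsum k
  rw [ek] at h1 ⊢
  have hp := hpos (a * m * k) (by positivity)
  have h2 : K * a ^ 2 * ∑ i ∈ Finset.range k, D i ^ 2 ≤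
      K * a ^ 2 * (L ^ 2 + L * φ (a * m * k) / (a * m)) :=
    mul_le_mul_of_nonneg_left h1 (by positivity)
  have h3 : K * a ^ 2 * (L ^ 2 + L * φ (a * m * k) / (a * m))
      = K * L ^ 2 * (a * a) + K * L * a * φ (a * m * k) * (1 / m) := by
    field_simp
  have h4 : K * L ^ 2 * (a * a) ≤ K * L ^ 2 * a := by
    apply mul_le_mul_of_nonneg_left _ (by positivity); nlinarith
  have h5 : K * L * a * φ (a * m * k) * (1 / m) ≤ K * L * a * φ (a * m * k) * 1 := by
    apply mul_le_mul_of_nonneg_left _ (by positivity)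
    rw [div_le_one (by linarith)]; exact hm0
  linarith

lemma gw_lint_indep {Ω ι β : Type*} [MeasurableSpace Ω] (μ : Measure Ω) [IsProbabilityMeasure μ]
    [MeasurableSpace ι] [Countable ι] [MeasurableSingletonClass ι] [MeasurableSpace β]
    (X : Ω → ι) (Y : Ω → β) (hX : Measurable X) (hY : Measurable Y) (hXY : IndepFun X Y μ)
    (G : ι → β → ENNReal) (hG : ∀ i, Measurable (G i)) :
    ∫⁻ ω, G (X ω) (Y ω) ∂μ = ∫⁻ ω, (∫⁻ ω', G (X ω) (Y ω') ∂μ) ∂μ := by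
  have hGm : Measurable (fun p : ι × β => G p.1 p.2) := measurable_from_prod_countable_right hG
  have h1 : ∫⁻ ω, G (X ω) (Y ω) ∂μ = ∫⁻ p, G p.1 p.2 ∂(μ.map (fun ω => (X ω, Y ω))) := by
    rw [lintegral_map hGm (hX.prodMk hY)]
  have : IsProbabilityMeasure (μ.map Y) := Measure.isProbabilityMeasure_map hY.aemeasurable
  rw [h1, (indepFun_iff_map_prod_eq_prod_map_map hX.aemeasurable hY.aemeasurable).1 hXY,
    lintegral_prod _ hGm.aemeasurable, lintegral_map (Measurable.of_discrete) hX]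
  refine lintegral_congr fun ω => ?_
  rw [lintegral_map (hG _) hY]

lemma gw_link_sum {Ω : Type*} [MeasurableSpace Ω] (μ : Measure Ω) [IsProbabilityMeasure μ]
    (ν : Measure ℕ) (X : ℕ → Ω → ℕ) (hX : ∀ i, Measurable (X i)) (hind : iIndepFun X μ)
    (hν : ∀ i, Measure.map (X i) μ = ν) (k : ℕ) : ∀ f : ℕ → ENNReal,
    ∫⁻ ω, f (∑ i ∈ Finset.range k, X i ω) ∂μ = gwI ν k f := by
  induction k with
  | zero => intro f; simp [gwI]
  | succ k ih =>
    intro f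
    have hi := (hind.indepFun_sum_range_succ hX k).symm
    have hm : Measurable (∑ j ∈ Finset.range k, X j) := by
      rw [show (∑ j ∈ Finset.range k, X j) = fun ω => ∑ j ∈ Finset.range k, X j ω from
        funext fun ω => Finset.sum_apply _ _ _]
      exact Finset.measurable_sum _ (fun i _ => hX i)
    have h := gw_lint_indep μ (X k) (∑ j ∈ Finset.range k, X j) (hX k) hm hi
      (fun a b => f (a + b)) (fun a => Measurable.of_discrete)
    simp only [gwI]
    calc ∫⁻ ω, f (∑ i ∈ Finset.range (k + 1), X i ω) ∂μ
        = ∫⁻ ω, f (X k ω + (∑ j ∈ Finset.range k, X j) ω) ∂μ := by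
          refine lintegral_congr fun ω => ?_
          rw [Finset.sum_range_succ, add_comm, Finset.sum_apply]
      _ = ∫⁻ ω, (∫⁻ ω', f (X k ω + (∑ j ∈ Finset.range k, X j) ω') ∂μ) ∂μ := h
      _ = ∫⁻ ω, gwI ν k (fun i => f (X k ω + i)) ∂μ := by
          refine lintegral_congr fun ω => ?_
          rw [← ih]
          simp only [Finset.sum_apply]
      _ = ∫⁻ j, gwI ν k (fun i => f (j + i)) ∂ν := by
          rw [← hν k, lintegral_map (Measurable.of_discrete) (hX k)]

lemma gw_meas_sum : Measurable (fun p : ℕ × (ℕ → ℕ) => ∑ i ∈ Finset.range p.1, p.2 i) := by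
  refine measurable_from_prod_countable_right fun k => ?_
  show Measurable (fun y : ℕ → ℕ => ∑ i ∈ Finset.range k, y i)
  exact Finset.measurable_sum (f := fun (i : ℕ) (y : ℕ → ℕ) => y i) _
    (fun i _ => measurable_pi_apply i)

lemma gw_markov {Ω : Type*} [mΩ : MeasurableSpace Ω] (μ : Measure Ω) [IsProbabilityMeasure μ]
    (ξ : ℕ → ℕ → Ω → ℕ) (hmeas : ∀ n i, Measurable (ξ n i))
    (hindep : iIndepFun (fun p : ℕ × ℕ => ξ p.1 p.2) μ)
    (hident : ∀ n i, Measure.map (ξ n i) μ = Measure.map (ξ 0 0) μ)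
    (Z : ℕ → Ω → ℕ) (hZ0 : ∀ ω, Z 0 ω = 1)
    (hZrec : ∀ n ω, Z (n + 1) ω = ∑ i ∈ Finset.range (Z n ω), ξ n i ω) :
    (∀ n, Measurable (Z n)) ∧ ∀ n l, l ≤ n → ∀ (h f : ℕ → ENNReal),
      ∫⁻ ω, h (Z l ω) * f (Z (n + 1) ω) ∂μ
        = ∫⁻ ω, h (Z l ω) * gwI (Measure.map (ξ 0 0) μ) (Z n ω) f ∂μ := by
  classical
  set F : ℕ → MeasurableSpace Ω := fun n =>
    ⨆ p ∈ {p : ℕ × ℕ | p.1 < n}, MeasurableSpace.comap (ξ p.1 p.2) inferInstance with hF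
  have hle : ∀ p : ℕ × ℕ, MeasurableSpace.comap (ξ p.1 p.2) inferInstance ≤ mΩ :=
    fun p => (hmeas p.1 p.2).comap_le
  have hFle : ∀ n, F n ≤ mΩ := fun n => iSup₂_le fun p _ => hle p
  have hFmono : Monotone F := by
    intro a b hab
    refine iSup₂_le fun p hp => ?_
    exact le_iSup₂_of_le p (lt_of_lt_of_le hp hab) le_rfl
  have hξF : ∀ n i, Measurable[F (n + 1)] (ξ n i) := by
    intro n i
    refine Measurable.mono (comap_measurable (ξ n i)) ?_ le_rfl
    exact le_iSup₂_of_le (f := fun (p : ℕ × ℕ) (_ : p ∈ {p : ℕ × ℕ | p.1 < n + 1}) =>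
      MeasurableSpace.comap (ξ p.1 p.2) inferInstance) (n, i) (Nat.lt_succ_self n) le_rfl
  have hZF : ∀ n, Measurable[F n] (Z n) := by
    intro n
    induction n with
    | zero =>
      have : Z 0 = fun _ => 1 := funext hZ0
      rw [this]; exact measurable_const
    | succ n ih =>
      have e : Z (n + 1) = (fun p : ℕ × (ℕ → ℕ) => ∑ i ∈ Finset.range p.1, p.2 i) ∘
          (fun ω => (Z n ω, fun i => ξ n i ω)) := by
        funext ω; simp [hZrec]
      rw [e]
      refine gw_meas_sum.comp ?_
      refine Measurable.prodMk (ih.mono (hFmono (Nat.le_succ n)) le_rfl) ?_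
      exact @measurable_pi_lambda _ _ _ (_) _ _ (fun i => hξF n i)
  refine ⟨fun n => (hZF n).mono (hFle n) le_rfl, fun n l hl h f => ?_⟩
  have hZm : ∀ n, Measurable (Z n) := fun n => (hZF n).mono (hFle n) le_rfl
  have hYm : Measurable (fun ω => fun i => ξ n i ω) := measurable_pi_lambda _ (fun i => hmeas n i)
  have hI : Indep (F n) (⨆ p ∈ {p : ℕ × ℕ | p.1 = n},
      MeasurableSpace.comap (ξ p.1 p.2) inferInstance) μ := by
    refine indep_iSup_of_disjoint hle hindep.iIndep ?_
    rw [Set.disjoint_left]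
    intro p hp hp'
    simp only [Set.mem_ofPred_eq] at hp hp'
    omega
  have hXY : IndepFun (fun ω => (Z l ω, Z n ω)) (fun ω => fun i => ξ n i ω) μ := by
    rw [IndepFun_iff_Indep]
    refine indep_of_indep_of_le_left (indep_of_indep_of_le_right hI ?_) ?_
    · refine Measurable.comap_le ?_
      refine @measurable_pi_lambda _ _ _ (_) _ _ (fun i => ?_)
      refine Measurable.mono (comap_measurable (ξ n i)) ?_ le_rfl
      exact le_iSup₂_of_le (f := fun (p : ℕ × ℕ) (_ : p ∈ {p : ℕ × ℕ | p.1 = n}) =>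
        MeasurableSpace.comap (ξ p.1 p.2) inferInstance) (n, i) rfl le_rfl
    · refine Measurable.comap_le ?_
      exact Measurable.prodMk ((hZF l).mono (hFmono hl) le_rfl) (hZF n)
  have hindn : iIndepFun (ξ n) μ := by
    have := hindep.precomp (g := fun i : ℕ => (n, i)) (fun a b hab => by simpa using hab)
    exact this
  have key := gw_lint_indep μ (fun ω => (Z l ω, Z n ω)) (fun ω => fun i => ξ n i ω)
    ((hZm l).prodMk (hZm n)) hYm hXY
    (fun q y => h q.1 * f (∑ i ∈ Finset.range q.2, y i))
    (fun q => by
      refine Measurable.const_mul ?_ _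
      exact (Measurable.of_discrete (f := f)).comp
        (Finset.measurable_sum (f := fun (i : ℕ) (y : ℕ → ℕ) => y i) _
          (fun i _ => measurable_pi_apply i)))
  calc ∫⁻ ω, h (Z l ω) * f (Z (n + 1) ω) ∂μ
      = ∫⁻ ω, h (Z l ω) * f (∑ i ∈ Finset.range (Z n ω), ξ n i ω) ∂μ := by
        simp only [hZrec]
    _ = _ := key
    _ = _ := by
        refine lintegral_congr fun ω => ?_
        have hms : Measurable (fun ω' => f (∑ i ∈ Finset.range (Z n ω), ξ n i ω')) :=
          (Measurable.of_discrete (f := f)).comp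
            (Finset.measurable_sum _ (fun i _ => hmeas n i))
        simp only []
        rw [lintegral_const_mul _ hms,
          gw_link_sum μ (Measure.map (ξ 0 0) μ) (ξ n) (hmeas n) hindn (hident n)]

lemma gw_concave_sub (f : ℝ → ℝ) (hf : ConcaveOn ℝ (Set.Ici 0) f) (x y : ℝ) (hx : 0 ≤ x)
    (hy : 0 ≤ y) : f (x + y) + f 0 ≤ f x + f y := by
  rcases hx.eq_or_lt with rfl | hx'
  · simp [add_comm]
  have hxy : 0 < x + y := by linarith
  have key : ∀ a b : ℝ, 0 ≤ a → 0 ≤ b → a + b = 1 → a * f (x + y) + b * f 0 ≤ f (a * (x + y)) := by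
    intro a b ha hb hab
    have := hf.2 (Set.mem_Ici.2 hxy.le) (Set.mem_Ici.2 (le_refl (0:ℝ))) ha hb hab
    simpa only [smul_eq_mul, mul_zero, add_zero] using this
  have h1 := key (x / (x + y)) (y / (x + y)) (by positivity) (by positivity) (by field_simp)
  have h2 := key (y / (x + y)) (x / (x + y)) (by positivity) (by positivity)
    (by field_simp; ring)
  rw [div_mul_cancel₀ _ hxy.ne'] at h1 h2
  have e1 : x / (x + y) * f (x + y) + y / (x + y) * f (x + y) = f (x + y) := by field_simp
  have e2 : y / (x + y) * f 0 + x / (x + y) * f 0 = f 0 := by field_simp; ring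
  linarith

lemma gw_concave_slope (f : ℝ → ℝ) (hf : ConcaveOn ℝ (Set.Ici 0) f) (w' w v h : ℝ) (hw' : 0 ≤ w')
    (hw : w' < w) (hv : w ≤ v) (hh : 0 ≤ h) :
    f (v + h) - f v ≤ (f w - f w') / (w - w') * h := by
  rcases hh.eq_or_lt with rfl | hh'
  · simp
  have key : (f (v + h) - f v) / (v + h - v) ≤ (f w - f w') / (w - w') := by
    rcases hv.eq_or_lt with rfl | hv'
    · exact hf.slope_anti_adjacent (Set.mem_Ici.2 hw') (Set.mem_Ici.2 (by linarith)) hw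
        (by linarith)
    · have h1 := hf.slope_anti_adjacent (Set.mem_Ici.2 (by linarith : 0 ≤ w))
        (Set.mem_Ici.2 (by linarith : 0 ≤ v + h)) hv' (by linarith)
      have h2 := hf.slope_anti_adjacent (Set.mem_Ici.2 hw')
        (Set.mem_Ici.2 (by linarith : 0 ≤ v)) hw hv'
      exact h1.trans h2
  rw [add_sub_cancel_left, div_le_iff₀ hh'] at key
  exact key

/-- the properties of the test function -/
structure GwPhi (φ : ℝ → ℝ) (L : ℝ) : Prop where
  conc : ConcaveOn ℝ (Set.Ici 0) φ
  cont : ContinuousOn φ (Set.Ici 0)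
  mono : MonotoneOn φ (Set.Ici 0)
  zero : φ 0 = 0
  L0 : 0 ≤ L
  lip : ∀ v h, 0 ≤ v → 0 ≤ h → φ (v + h) - φ v ≤ L * h

lemma gw_phi_of_psi (ψ : ℝ → ℝ) (hc : ConcaveOn ℝ (Set.Ici 0) ψ) (hm : MonotoneOn ψ (Set.Ici 0))
    (hp : ∀ x, 0 ≤ x → 0 ≤ ψ x) (b θ : ℝ) (hb : 0 < b) (hθ0 : 0 ≤ θ) (hθ1 : θ ≤ 1) :
    GwPhi (fun x => θ * (ψ (x + b) - ψ b)) (ψ b / b) ∧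
      ∀ x, 0 ≤ x → θ * (ψ (x + b) - ψ b) ≤ θ * ψ x := by
  have hmem : ∀ x ∈ Set.Ici (0:ℝ), x + b ∈ Set.Ici (0:ℝ) := fun x hx => by
    simp only [Set.mem_Ici] at hx ⊢; linarith
  refine ⟨⟨?_, ?_, ?_, by simp, div_nonneg (hp b hb.le) hb.le, ?_⟩, ?_⟩
  · refine ⟨convex_Ici 0, ?_⟩
    intro x hx y hy s t hs ht hst
    have := hc.2 (hmem x hx) (hmem y hy) hs ht hst
    simp only [smul_eq_mul] at this ⊢
    have e : s * (x + b) + t * (y + b) = s * x + t * y + b := by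
      linear_combination b * hst
    rw [e] at this
    have e2 : s * (θ * (ψ (x + b) - ψ b)) + t * (θ * (ψ (y + b) - ψ b))
        = θ * (s * ψ (x + b) + t * ψ (y + b) - ψ b) := by
      linear_combination (-θ * ψ b) * hst
    rw [e2]
    exact mul_le_mul_of_nonneg_left (by linarith) hθ0
  · have h1 : ContinuousOn ψ (Set.Ioi 0) := by
      have := hc.continuousOn_interior
      rwa [interior_Ici] at this
    refine continuousOn_const.mul (ContinuousOn.sub ?_ continuousOn_const)
    refine h1.comp (by fun_prop) ?_
    intro x hx
    simp only [Set.mem_Ici, Set.mem_Ioi] at hx ⊢; linarith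
  · intro x hx y hy hxy
    exact mul_le_mul_of_nonneg_left (by linarith [hm (hmem x hx) (hmem y hy) (by linarith)]) hθ0
  · intro v h hv hh
    have h1 := gw_concave_slope ψ hc 0 b (v + b) h le_rfl hb (by linarith) hh
    have h2 : (ψ b - ψ 0) / (b - 0) * h ≤ ψ b / b * h := by
      refine mul_le_mul_of_nonneg_right ?_ hh
      rw [sub_zero]
      exact div_le_div_of_nonneg_right (by linarith [hp 0 le_rfl]) hb.le
    have h3 : 0 ≤ ψ (v + b + h) - ψ (v + b) := sub_nonneg.2
      (hm (Set.mem_Ici.2 (by linarith)) (Set.mem_Ici.2 (by linarith)) (by linarith))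
    have e : v + h + b = v + b + h := by ring
    simp only [e]
    nlinarith
  · intro x hx
    refine mul_le_mul_of_nonneg_left ?_ hθ0
    linarith [gw_concave_sub ψ hc x b hx hb.le, hp 0 le_rfl]

lemma gw_phi_sum_c (ν : Measure ℕ) [IsProbabilityMeasure ν] (m : ℝ) (hm0 : 1 ≤ m)
    (hν : Integrable (fun j : ℕ => (j : ℝ)) ν) (hm : m = ∫ j, (j : ℝ) ∂ν)
    (φ : ℝ → ℝ) (L : ℝ) (H : GwPhi φ L) (K : ℝ)
    (hK : Integrable (fun j : ℕ => ((j : ℝ) - m) ^ 2 * Real.exp (φ |(j : ℝ) - m|)) ν)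
    (hKv : ∫ j, ((j : ℝ) - m) ^ 2 * Real.exp (φ |(j : ℝ) - m|) ∂ν ≤ K)
    (a : ℝ) (ha0 : 0 < a) (ha1 : a ≤ 1) (c : ℝ) (hc0 : 0 ≤ c) (hc1 : c ≤ 1) (k : ℕ) :
    gwI ν k (fun j => ENNReal.ofReal (Real.exp (c * φ (a * (j : ℝ)))))
      ≤ ENNReal.ofReal (Real.exp (c * φ (a * m * k) * (1 + K * L * a) + K * L ^ 2 * a)) := by
  have hpos : ∀ x, 0 ≤ x → 0 ≤ φ x := fun x hx => by
    rw [← H.zero]; exact H.mono (Set.mem_Ici.2 le_rfl) hx hx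
  have hpt : ∀ j : ℕ, ((j : ℝ) - m) ^ 2 * Real.exp (c * φ |(j : ℝ) - m|)
      ≤ ((j : ℝ) - m) ^ 2 * Real.exp (φ |(j : ℝ) - m|) := fun j => by
    refine mul_le_mul_of_nonneg_left (Real.exp_le_exp.2 ?_) (sq_nonneg _)
    nlinarith [hpos _ (abs_nonneg ((j:ℝ) - m))]
  have hKc : Integrable (fun j : ℕ => ((j : ℝ) - m) ^ 2 * Real.exp (c * φ |(j : ℝ) - m|)) ν := by
    refine hK.mono' (Measurable.of_discrete).aestronglyMeasurable
      (Eventually.of_forall fun j => ?_)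
    rw [Real.norm_of_nonneg (by positivity)]
    exact hpt j
  have hcc : ConcaveOn ℝ (Set.Ici 0) (fun x => c * φ x) := by
    simpa using H.conc.smul hc0
  refine gw_phi_sum' ν m hm0 hν hm (fun x => c * φ x) hcc (continuousOn_const.mul H.cont)
    (fun x hx y hy hxy => mul_le_mul_of_nonneg_left (H.mono hx hy hxy) hc0) ?_
    (gw_concave_slope _ hcc) (by simp [H.zero]) L H.L0 ?_ K ?_ hKc ?_ a ha0 ha1 k
  · intro x y hx hy
    have := gw_concave_sub _ hcc x y hx hy
    simp only [H.zero, mul_zero, add_zero] at this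
    exact this
  · intro v h hv hh
    have h1 := H.lip v h hv hh
    have h2 := H.mono (Set.mem_Ici.2 hv) (Set.mem_Ici.2 (by linarith : 0 ≤ v + h)) (by linarith)
    show c * φ (v + h) - c * φ v ≤ L * h
    nlinarith
  · exact le_trans (integral_nonneg fun j => by positivity) hKv
  · exact (integral_mono hKc hK hpt).trans hKv

lemma gw_upper {Ω : Type*} [MeasurableSpace Ω] (μ : Measure Ω) [IsProbabilityMeasure μ]
    (ν : Measure ℕ) [IsProbabilityMeasure ν] (m : ℝ) (hm1 : 1 < m)
    (hν : Integrable (fun j : ℕ => (j : ℝ)) ν) (hm : m = ∫ j, (j : ℝ) ∂ν)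
    (Z : ℕ → Ω → ℕ) (hZ0 : ∀ ω, Z 0 ω = 1) (hZm : ∀ n, Measurable (Z n))
    (hM : ∀ n l, l ≤ n → ∀ (h f : ℕ → ENNReal),
      ∫⁻ ω, h (Z l ω) * f (Z (n + 1) ω) ∂μ = ∫⁻ ω, h (Z l ω) * gwI ν (Z n ω) f ∂μ)
    (φ : ℝ → ℝ) (L : ℝ) (H : GwPhi φ L) (K : ℝ)
    (hK : Integrable (fun j : ℕ => ((j : ℝ) - m) ^ 2 * Real.exp (φ |(j : ℝ) - m|)) ν)
    (hKv : ∫ j, ((j : ℝ) - m) ^ 2 * Real.exp (φ |(j : ℝ) - m|) ∂ν ≤ K)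
    (κ : ℝ) (hκ1 : κ ≤ 1) (hκ : K * L ≤ κ * (1 - 1 / m)) :
    ∃ C : ℝ, ∀ (n : ℕ) (x : ℝ), 0 ≤ x → (μ {ω | x < (Z n ω : ℝ) / m ^ n}).toReal
      ≤ Real.exp (C - (1 - κ) * φ (m * x)) := by
  have hm0 : 0 < m := by linarith
  have hK0 : 0 ≤ K := le_trans (integral_nonneg fun j => by positivity) hKv
  have hg : 0 < 1 - 1 / m := by
    rw [sub_pos, div_lt_one hm0]; exact hm1
  have hκ0 : 0 ≤ κ := by
    by_contra hneg
    push Not at hneg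
    have := mul_nonneg hK0 H.L0
    nlinarith
  have hpos : ∀ x, 0 ≤ x → 0 ≤ φ x := fun x hx => by
    rw [← H.zero]; exact H.mono (Set.mem_Ici.2 le_rfl) hx hx
  set B : ℝ := K * L ^ 2 / (1 - 1 / m) with hB
  have hB0 : 0 ≤ B := by positivity
  set q : ℕ → ℝ := fun n => (m ^ n)⁻¹ with hq
  have hq0 : ∀ n, 0 < q n := fun n => by positivity
  have hq1 : ∀ n, q n ≤ 1 := fun n => inv_le_one_of_one_le₀ (one_le_pow₀ hm1.le)
  have hqs : ∀ n, q (n + 1) = q n * (1 / m) := fun n => by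
    simp only [hq, pow_succ, mul_inv, one_div]
  have main : ∀ n, ∫⁻ ω, ENNReal.ofReal (Real.exp ((1 - κ * (1 - q n)) * φ (m * q n * Z n ω))) ∂μ
      ≤ ENNReal.ofReal (Real.exp (φ m + B * (1 - q n))) := by
    intro n
    induction n with
    | zero => simp [hq, hZ0]
    | succ n ih =>
      have e : m * q (n + 1) = q n := by rw [hqs]; field_simp
      set c : ℝ := 1 - κ * (1 - q (n + 1)) with hc
      have hc0 : 0 ≤ c := by nlinarith [hq0 (n + 1), hq1 (n + 1)]
      have hc1 : c ≤ 1 := by nlinarith [hq0 (n + 1), hq1 (n + 1)]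
      have hstep : c * (1 + K * L * q n) ≤ 1 - κ * (1 - q n) := by
        have h1 : K * L * q n ≤ κ * (1 - 1 / m) * q n :=
          mul_le_mul_of_nonneg_right hκ (hq0 n).le
        have h2 : c * (K * L * q n) ≤ 1 * (K * L * q n) :=
          mul_le_mul_of_nonneg_right hc1 (mul_nonneg (mul_nonneg hK0 H.L0) (hq0 n).le)
        have h3 : c = 1 - κ * (1 - q n * (1 / m)) := by rw [hc, hqs]
        have h4 : c + κ * (1 - 1 / m) * q n = 1 - κ * (1 - q n) := by rw [h3]; ring
        linarith
      have hM' := hM n 0 (Nat.zero_le n) (fun _ => 1)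
        (fun j => ENNReal.ofReal (Real.exp (c * φ (q n * (j : ℝ)))))
      simp only [one_mul] at hM'
      rw [e, hM']
      calc ∫⁻ ω, gwI ν (Z n ω) (fun j => ENNReal.ofReal (Real.exp (c * φ (q n * (j : ℝ))))) ∂μ
          ≤ ∫⁻ ω, ENNReal.ofReal (Real.exp (K * L ^ 2 * q n)) *
              ENNReal.ofReal (Real.exp ((1 - κ * (1 - q n)) * φ (m * q n * Z n ω))) ∂μ := by
            refine lintegral_mono fun ω => ?_
            refine (gw_phi_sum_c ν m hm1.le hν hm φ L H K hK hKv (q n) (hq0 n) (hq1 n) c hc0 hc1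
              (Z n ω)).trans ?_
            rw [← ENNReal.ofReal_mul (Real.exp_pos _).le, ← Real.exp_add]
            refine ENNReal.ofReal_le_ofReal (Real.exp_le_exp.2 ?_)
            have hp := hpos (m * q n * Z n ω)
              (mul_nonneg (mul_nonneg hm0.le (hq0 n).le) (Nat.cast_nonneg _))
            rw [mul_comm (q n) m]
            have := mul_le_mul_of_nonneg_right hstep hp
            linarith
        _ = ENNReal.ofReal (Real.exp (K * L ^ 2 * q n)) *
              ∫⁻ ω, ENNReal.ofReal (Real.exp ((1 - κ * (1 - q n)) * φ (m * q n * Z n ω))) ∂μ := by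
            refine lintegral_const_mul _ ?_
            exact (Measurable.of_discrete (f := fun k : ℕ =>
              ENNReal.ofReal (Real.exp ((1 - κ * (1 - q n)) * φ (m * q n * k))))).comp (hZm n)
        _ ≤ ENNReal.ofReal (Real.exp (K * L ^ 2 * q n)) * _ := mul_le_mul_right ih _
        _ = _ := by
            rw [← ENNReal.ofReal_mul (Real.exp_pos _).le, ← Real.exp_add]
            congr 2
            have : B * (1 - 1 / m) = K * L ^ 2 := div_mul_cancel₀ _ hg.ne'
            rw [hqs, ← this]; ring
  refine ⟨φ m + B, fun n x hx => ?_⟩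
  have hc0 : 1 - κ ≤ 1 - κ * (1 - q n) := by nlinarith [hq0 n, hq1 n]
  set t := Real.exp ((1 - κ) * φ (m * x)) with ht
  have h1 : ENNReal.ofReal t * μ {ω | x < (Z n ω : ℝ) / m ^ n}
      ≤ ENNReal.ofReal (Real.exp (φ m + B)) := by
    calc ENNReal.ofReal t * μ {ω | x < (Z n ω : ℝ) / m ^ n}
        ≤ ENNReal.ofReal t * μ {ω | ENNReal.ofReal t ≤
            ENNReal.ofReal (Real.exp ((1 - κ * (1 - q n)) * φ (m * q n * Z n ω)))} := by
          refine mul_le_mul_right (measure_mono ?_) _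
          intro ω hω
          simp only [Set.mem_ofPred_eq] at hω ⊢
          refine ENNReal.ofReal_le_ofReal (Real.exp_le_exp.2 ?_)
          have h2 : m * x ≤ m * q n * Z n ω := by
            rw [mul_assoc]
            refine mul_le_mul_of_nonneg_left ?_ hm0.le
            rw [div_eq_inv_mul] at hω; exact hω.le
          have h0 : 0 ≤ m * x := mul_nonneg hm0.le hx
          have h3 := H.mono (Set.mem_Ici.2 h0) (Set.mem_Ici.2 (h0.trans h2)) h2
          exact mul_le_mul hc0 h3 (hpos _ h0) (by linarith)
      _ ≤ ∫⁻ ω, ENNReal.ofReal (Real.exp ((1 - κ * (1 - q n)) * φ (m * q n * Z n ω))) ∂μ := by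
          refine mul_meas_ge_le_lintegral₀ ?_ _
          exact ((Measurable.of_discrete (f := fun k : ℕ =>
              ENNReal.ofReal (Real.exp ((1 - κ * (1 - q n)) * φ (m * q n * k))))).comp
                (hZm n)).aemeasurable
      _ ≤ _ := main n
      _ ≤ _ := by
          refine ENNReal.ofReal_le_ofReal (Real.exp_le_exp.2 ?_)
          nlinarith [hq0 n]
  have h2 := ENNReal.toReal_mono ENNReal.ofReal_ne_top h1
  rw [ENNReal.toReal_mul, ENNReal.toReal_ofReal (Real.exp_pos _).le,
    ENNReal.toReal_ofReal (Real.exp_pos _).le] at h2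
  rw [Real.exp_sub, le_div_iff₀ (Real.exp_pos _)]
  linarith

lemma gw_lower {Ω : Type*} [MeasurableSpace Ω] (μ : Measure Ω) [IsProbabilityMeasure μ]
    (ν : Measure ℕ) [IsProbabilityMeasure ν] (m : ℝ) (hm1 : 1 < m)
    (hν : Integrable (fun j : ℕ => (j : ℝ)) ν) (hm : m = ∫ j, (j : ℝ) ∂ν)
    (Z : ℕ → Ω → ℕ) (hZm : ∀ n, Measurable (Z n))
    (hM : ∀ n l, l ≤ n → ∀ (h f : ℕ → ENNReal),
      ∫⁻ ω, h (Z l ω) * f (Z (n + 1) ω) ∂μ = ∫⁻ ω, h (Z l ω) * gwI ν (Z n ω) f ∂μ)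
    (hV : Integrable (fun j : ℕ => ((j : ℝ) - m) ^ 2) ν)
    (κ : ℝ) (hκ0 : 0 < κ) (hκ1 : κ ≤ 1) :
    ∃ θ : ℝ, 0 < θ ∧ ∀ (n : ℕ), 1 ≤ n → ∀ x y : ℝ, 0 ≤ x → 0 ≤ y →
      (1 - Real.exp (θ * ((1 + κ) * x - y / m))) * (μ {ω | y < (Z 1 ω : ℝ)}).toReal
        ≤ (μ {ω | x < (Z n ω : ℝ) / m ^ n}).toReal := by
  have hm0 : 0 < m := by linarith
  set C : ℝ := (∫ j, ((j : ℝ) - m) ^ 2 ∂ν) * Real.exp m with hC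
  have hC0 : 0 ≤ C := mul_nonneg (integral_nonneg fun j => sq_nonneg _) (Real.exp_pos _).le
  set θ : ℝ := min (1 / 2) (κ * (m - 1) / (4 * C + 1)) with hθ
  have hmm : 0 < m - 1 := by linarith
  have hθ0 : 0 < θ := lt_min (by norm_num) (by positivity)
  have hθ1 : θ ≤ 1 / 2 := min_le_left _ _
  have hθ2 : 4 * C * θ ≤ κ * (m - 1) := by
    have : θ ≤ κ * (m - 1) / (4 * C + 1) := min_le_right _ _
    rw [le_div_iff₀ (by linarith)] at this
    nlinarith
  refine ⟨θ, hθ0, ?_⟩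
  set q : ℕ → ℝ := fun n => (m ^ n)⁻¹ with hq
  have hq0 : ∀ n, 0 < q n := fun n => by positivity
  have hq1 : ∀ n, q n ≤ 1 := fun n => inv_le_one_of_one_le₀ (one_le_pow₀ hm1.le)
  have hqs : ∀ n, q n = q (n + 1) * m := fun n => by
    simp only [hq, pow_succ, mul_inv]; field_simp
  set r : ℕ → ℝ := fun n => 1 + κ * (1 - q n) with hr
  have hr1 : ∀ n, 1 ≤ r n := fun n => by
    have := mul_nonneg hκ0.le (sub_nonneg.2 (hq1 n)); simp only [hr]; linarith
  have hr2 : ∀ n, r n ≤ 1 + κ := fun n => by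
    simp only [hr]; nlinarith [hq0 n]
  set s : ℕ → ℝ := fun n => θ * r n * q n with hs
  have hs0 : ∀ n, 0 < s n := fun n => by
    have := hr1 n; have := hq0 n; simp only [hs]; positivity
  have hs1 : ∀ n, s n ≤ 1 := fun n => by
    have h1 := hr1 n
    have h2 : θ * r n ≤ 1 := by nlinarith [hr2 n]
    simp only [hs]; nlinarith [hq0 n, hq1 n, mul_pos hθ0 (by linarith : 0 < r n)]
  have hstep : ∀ n, s n ≤ s (n + 1) * m - C * s (n + 1) ^ 2 := by
    intro n
    set p := q (n + 1) with hp
    have hp0 : 0 < p := hq0 _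
    have hp1 : p ≤ 1 := hq1 _
    have e1 : s n = θ * (1 + κ * (1 - p * m)) * (p * m) := by simp only [hs, hr]; rw [hqs n]
    have e2 : s (n + 1) = θ * r (n + 1) * p := rfl
    have e3 : r (n + 1) = 1 + κ * (1 - p) := rfl
    have e4 : s (n + 1) * m - s n = θ * p * p * m * (κ * (m - 1)) := by rw [e1, e2, e3]; ring
    have h5 : C * s (n + 1) ^ 2 ≤ θ * p * p * (4 * C * θ) := by
      have h6 : r (n + 1) ^ 2 ≤ 4 := by nlinarith [hr1 (n + 1), hr2 (n + 1)]
      have : C * s (n + 1) ^ 2 = (C * θ * θ * p * p) * r (n + 1) ^ 2 := by rw [e2]; ring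
      rw [this]
      have h7 : (C * θ * θ * p * p) * r (n + 1) ^ 2 ≤ (C * θ * θ * p * p) * 4 :=
        mul_le_mul_of_nonneg_left h6 (by positivity)
      linarith
    have h8 : θ * p * p * (4 * C * θ) ≤ θ * p * p * (κ * (m - 1)) :=
      mul_le_mul_of_nonneg_left hθ2 (by positivity)
    have h9 : θ * p * p * (κ * (m - 1)) ≤ θ * p * p * m * (κ * (m - 1)) := by
      have : 0 ≤ θ * p * p * (κ * (m - 1)) := by positivity
      nlinarith
    linarith
  have main : ∀ (h : ℕ → ENNReal) (n : ℕ), ∫⁻ ω, h (Z 1 ω) *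
      ENNReal.ofReal (Real.exp (0 - s (n + 1) * (Z (n + 1) ω : ℝ))) ∂μ
      ≤ ∫⁻ ω, h (Z 1 ω) * ENNReal.ofReal (Real.exp (0 - s 1 * (Z 1 ω : ℝ))) ∂μ := by
    intro h n
    induction n with
    | zero => simp
    | succ n ih =>
      refine le_trans ?_ ih
      rw [hM (n + 1) 1 (by omega) h
        (fun j => ENNReal.ofReal (Real.exp (0 - s (n + 1 + 1) * (j : ℝ))))]
      refine lintegral_mono fun ω => mul_le_mul_right ?_ _
      have h1 := gw_laplace_single ν m hm0.le hν hm _ hV le_rfl (s (n + 1 + 1))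
        (hs0 _).le (hs1 _)
      refine (gw_laplace ν (s (n + 1 + 1)) (s (n + 1)) (h1.trans ?_) (Z (n + 1) ω) 0)
      refine ENNReal.ofReal_le_ofReal (Real.exp_le_exp.2 ?_)
      have := hstep (n + 1)
      linarith
  intro n hn x y hx hy
  obtain ⟨n, rfl⟩ := Nat.exists_eq_succ_of_ne_zero (by omega : n ≠ 0)
  simp only [Nat.succ_eq_add_one]
  set A : Set Ω := {ω | y < (Z 1 ω : ℝ)} with hA
  set G : Set Ω := {ω | x < (Z (n + 1) ω : ℝ) / m ^ (n + 1)} with hG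
  have hAm : MeasurableSet A := by
    have : MeasurableSet {k : ℕ | y < (k : ℝ)} := MeasurableSet.of_discrete
    exact hZm 1 this
  have hGm : MeasurableSet G := by
    have : MeasurableSet {k : ℕ | x < (k : ℝ) / m ^ (n + 1)} := MeasurableSet.of_discrete
    exact hZm (n + 1) this
  classical
  have hbd := main (fun k => if y < (k : ℝ) then 1 else 0) n
  set E := Real.exp (θ * ((1 + κ) * x - y / m)) with hE
  set E1 := Real.exp (-(θ * ((1 + κ) * x))) with hE1
  set E2 := Real.exp (-(θ * (y / m))) with hE2
  have hl : ENNReal.ofReal E1 * μ (A \ G) ≤ ∫⁻ ω, (if y < (Z 1 ω : ℝ) then 1 else 0) *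
      ENNReal.ofReal (Real.exp (0 - s (n + 1) * (Z (n + 1) ω : ℝ))) ∂μ := by
    rw [← setLIntegral_const, ← lintegral_indicator (hAm.diff hGm)]
    refine lintegral_mono fun ω => ?_
    by_cases hω : ω ∈ A \ G
    · rw [Set.indicator_of_mem hω]
      have h1 : y < (Z 1 ω : ℝ) := hω.1
      have h2 : ¬ (x < (Z (n + 1) ω : ℝ) / m ^ (n + 1)) := hω.2
      rw [if_pos h1, one_mul]
      refine ENNReal.ofReal_le_ofReal (Real.exp_le_exp.2 ?_)
      rw [not_lt, div_eq_inv_mul] at h2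
      have h3 : s (n + 1) * (Z (n + 1) ω : ℝ) = θ * r (n + 1) * (q (n + 1) * (Z (n + 1) ω : ℝ)) := by
        simp only [hs]; ring
      have h4 : θ * r (n + 1) * (q (n + 1) * (Z (n + 1) ω : ℝ)) ≤ θ * (1 + κ) * x := by
        refine mul_le_mul (mul_le_mul_of_nonneg_left (hr2 _) hθ0.le) h2 ?_ (by positivity)
        exact mul_nonneg (hq0 _).le (Nat.cast_nonneg _)
      linarith
    · rw [Set.indicator_of_notMem hω]; exact zero_le
  have hr' : ∫⁻ ω, (if y < (Z 1 ω : ℝ) then 1 else 0) *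
      ENNReal.ofReal (Real.exp (0 - s 1 * (Z 1 ω : ℝ))) ∂μ ≤ ENNReal.ofReal E2 * μ A := by
    rw [← setLIntegral_const, ← lintegral_indicator hAm]
    refine lintegral_mono fun ω => ?_
    by_cases hω : ω ∈ A
    · rw [Set.indicator_of_mem hω]
      have h1 : y < (Z 1 ω : ℝ) := hω
      rw [if_pos h1, one_mul]
      refine ENNReal.ofReal_le_ofReal (Real.exp_le_exp.2 ?_)
      have h3 : s 1 = θ * r 1 / m := by simp only [hs, hq]; rw [pow_one, div_eq_mul_inv]
      have h4 : θ * (y / m) ≤ θ * r 1 / m * Z 1 ω := by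
        have : θ * (y / m) = θ * 1 / m * y := by ring
        rw [this]
        have := hr1 1
        gcongr
      rw [h3]; linarith
    · have h1 : ¬ y < (Z 1 ω : ℝ) := hω
      rw [if_neg h1, zero_mul]; exact zero_le
  have hfin := (hl.trans hbd).trans hr'
  have h2 := ENNReal.toReal_mono (ENNReal.mul_ne_top ENNReal.ofReal_ne_top (measure_ne_top μ A)) hfin
  rw [ENNReal.toReal_mul, ENNReal.toReal_mul, ENNReal.toReal_ofReal (Real.exp_pos _).le,
    ENNReal.toReal_ofReal (Real.exp_pos _).le] at h2
  have hEE : E * E1 = E2 := by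
    rw [hE, hE1, hE2, ← Real.exp_add]; congr 1; ring
  change E1 * _ ≤ E2 * _ at h2
  rw [← hEE] at h2
  have h3 : (μ (A \ G)).toReal ≤ E * (μ A).toReal := by
    have hE1p : 0 < E1 := Real.exp_pos _
    refine le_of_mul_le_mul_left ?_ hE1p
    linarith
  have h4 : (μ A).toReal ≤ (μ (A \ G)).toReal + (μ G).toReal := by
    rw [← ENNReal.toReal_add (measure_ne_top _ _) (measure_ne_top _ _)]
    refine ENNReal.toReal_mono (ENNReal.add_ne_top.2 ⟨measure_ne_top _ _, measure_ne_top _ _⟩) ?_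
    refine (measure_mono ?_).trans (measure_union_le _ _)
    intro ω hω
    by_cases h : ω ∈ G
    · exact Or.inr h
    · exact Or.inl ⟨hω, h⟩
  linarith

lemma gw_potter (R : ℝ → ℝ) (hmono : Monotone R) (hinf : Tendsto R atTop atTop) (β : ℝ)
    (hRV : ∀ lam > (0 : ℝ), Tendsto (fun x => R (lam * x) / R x) atTop (nhds (lam ^ β)))
    (g1 g2 q : ℝ) (hg1 : β < g1) (hg2 : g2 < β) (hg20 : 0 < g2) (hq : 1 < q) :
    ∃ Y : ℝ, 0 < Y ∧ ∀ y, Y ≤ y → 0 < R y ∧ ∀ l : ℝ, 1 ≤ l →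
      R (l * y) ≤ q ^ g1 * l ^ g1 * R y ∧ l ^ g2 * R y ≤ q ^ g2 * R (l * y) := by
  have hq0 : 0 < q := by linarith
  have e1 : ∀ᶠ x in atTop, R (q * x) / R x < q ^ g1 :=
    (hRV q hq0).eventually_lt_const (Real.rpow_lt_rpow_of_exponent_lt hq hg1)
  have e2 : ∀ᶠ x in atTop, q ^ g2 < R (q * x) / R x :=
    (hRV q hq0).eventually_const_lt (Real.rpow_lt_rpow_of_exponent_lt hq hg2)
  obtain ⟨Y, hY⟩ := eventually_atTop.1
    ((e1.and e2).and ((hinf.eventually_gt_atTop 0).and (eventually_gt_atTop 0)))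
  refine ⟨Y, (hY Y le_rfl).2.2, fun y hy => ⟨(hY y hy).2.1, fun l hl => ?_⟩⟩
  have hy0 : 0 < y := (hY y hy).2.2
  have hRy : 0 < R y := (hY y hy).2.1
  have it : ∀ k : ℕ, R (q ^ k * y) ≤ (q ^ g1) ^ k * R y ∧ (q ^ g2) ^ k * R y ≤ R (q ^ k * y) := by
    intro k
    induction k with
    | zero => simp
    | succ k ih =>
      have hge : Y ≤ q ^ k * y := by
        have : 1 * y ≤ q ^ k * y := mul_le_mul_of_nonneg_right (one_le_pow₀ hq.le) hy0.le
        linarith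
      obtain ⟨⟨h1, h2⟩, h3, _⟩ := hY _ hge
      rw [div_lt_iff₀ h3] at h1
      rw [lt_div_iff₀ h3] at h2
      have e : q ^ (k + 1) * y = q * (q ^ k * y) := by ring
      rw [e]
      constructor
      · calc R (q * (q ^ k * y)) ≤ q ^ g1 * R (q ^ k * y) := h1.le
          _ ≤ q ^ g1 * ((q ^ g1) ^ k * R y) :=
            mul_le_mul_of_nonneg_left ih.1 (Real.rpow_pos_of_pos hq0 _).le
          _ = _ := by ring
      · calc (q ^ g2) ^ (k + 1) * R y = q ^ g2 * ((q ^ g2) ^ k * R y) := by ring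
          _ ≤ q ^ g2 * R (q ^ k * y) :=
            mul_le_mul_of_nonneg_left ih.2 (Real.rpow_pos_of_pos hq0 _).le
          _ ≤ _ := h2.le
  obtain ⟨k, hk1, hk2⟩ := exists_nat_pow_near hl hq
  have hpw : ∀ (g : ℝ) (k : ℕ), (q ^ g) ^ k = (q ^ k) ^ g := fun g k => by
    rw [← Real.rpow_natCast, ← Real.rpow_mul hq0.le, ← Real.rpow_natCast, ← Real.rpow_mul hq0.le,
      mul_comm]
  constructor
  · calc R (l * y) ≤ R (q ^ (k + 1) * y) := hmono (mul_le_mul_of_nonneg_right hk2.le hy0.le)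
      _ ≤ (q ^ g1) ^ (k + 1) * R y := (it (k + 1)).1
      _ = q ^ g1 * (q ^ k) ^ g1 * R y := by rw [← hpw]; ring
      _ ≤ _ := by
        have : (q ^ k) ^ g1 ≤ l ^ g1 :=
          Real.rpow_le_rpow (by positivity) hk1 (by linarith)
        gcongr
  · calc l ^ g2 * R y ≤ (q ^ (k + 1)) ^ g2 * R y := by
          have : l ^ g2 ≤ (q ^ (k + 1)) ^ g2 :=
            Real.rpow_le_rpow (by linarith) hk2.le hg20.le
          gcongr
      _ = q ^ g2 * ((q ^ g2) ^ k * R y) := by rw [← hpw]; ring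
      _ ≤ q ^ g2 * R (q ^ k * y) :=
          mul_le_mul_of_nonneg_left (it k).2 (Real.rpow_pos_of_pos hq0 _).le
      _ ≤ q ^ g2 * R (l * y) := by
          refine mul_le_mul_of_nonneg_left ?_ (Real.rpow_pos_of_pos hq0 _).le
          exact hmono (mul_le_mul_of_nonneg_right hk1 hy0.le)

lemma gw_growth (R : ℝ → ℝ) (hmono : Monotone R) (hinf : Tendsto R atTop atTop) (β : ℝ)
    (hβ0 : 0 < β) (hβ1 : β < 1)
    (hRV : ∀ lam > (0 : ℝ), Tendsto (fun x => R (lam * x) / R x) atTop (nhds (lam ^ β))) :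
    (∀ N : ℝ, ∀ᶠ x in atTop, N * Real.log x ≤ R x) ∧
      (∀ ρ > (0 : ℝ), ∀ᶠ x in atTop, R x ≤ ρ * x) := by
  obtain ⟨Y, hY0, hY⟩ := gw_potter R hmono hinf β hRV ((1 + β) / 2) (β / 2) 2 (by linarith)
    (by linarith) (by linarith) (by norm_num)
  obtain ⟨hRY, hl⟩ := hY Y le_rfl
  constructor
  · intro N
    have hp : 0 < R Y / (2 ^ (β / 2) * Y ^ (β / 2)) := by positivity
    have hlo := (isLittleO_log_rpow_atTop (half_pos hβ0)).def
      (show 0 < (R Y / (2 ^ (β / 2) * Y ^ (β / 2))) / (|N| + 1) by positivity)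
    filter_upwards [hlo, eventually_ge_atTop Y, eventually_ge_atTop 1] with x hx hxY hx1
    have h1 := (hl (x / Y) (by rwa [one_le_div hY0])).2
    rw [div_mul_cancel₀ _ hY0.ne', Real.div_rpow (by linarith) hY0.le] at h1
    have h2 : R Y / (2 ^ (β / 2) * Y ^ (β / 2)) * x ^ (β / 2) ≤ R x := by
      have e : R Y / (2 ^ (β / 2) * Y ^ (β / 2)) * x ^ (β / 2)
        = (x ^ (β / 2) / Y ^ (β / 2) * R Y) / 2 ^ (β / 2) := by field_simp
      rw [e, div_le_iff₀ (by positivity)]; linarith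
    rw [Real.norm_of_nonneg (Real.log_nonneg hx1),
      Real.norm_of_nonneg (Real.rpow_nonneg (by linarith) _)] at hx
    set c := R Y / (2 ^ (β / 2) * Y ^ (β / 2))
    have h3 : (|N| + 1) * Real.log x ≤ c * x ^ (β / 2) := by
      have := mul_le_mul_of_nonneg_left hx (by positivity : 0 ≤ |N| + 1)
      have e : (|N| + 1) * (c / (|N| + 1) * x ^ (β / 2)) = c * x ^ (β / 2) := by field_simp
      linarith
    have h4 : N * Real.log x ≤ (|N| + 1) * Real.log x :=
      mul_le_mul_of_nonneg_right (by linarith [le_abs_self N]) (Real.log_nonneg hx1)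
    linarith
  · intro ρ hρ
    set g := (1 + β) / 2 with hg
    have hg1 : 0 < 1 - g := by rw [hg]; linarith
    set C := 2 ^ g * R Y / Y ^ g with hC
    have hC0 : 0 < C := by positivity
    have ht := (tendsto_rpow_neg_atTop hg1).eventually_lt_const
      (show 0 < ρ / C by positivity)
    filter_upwards [ht, eventually_ge_atTop Y] with x hx hxY
    have hx0 : 0 < x := by linarith
    have h1 := (hl (x / Y) (by rwa [one_le_div hY0])).1
    rw [div_mul_cancel₀ _ hY0.ne', Real.div_rpow (by linarith) hY0.le] at h1
    have e : x ^ g = x ^ (-(1 - g)) * x := by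
      nth_rewrite 3 [← Real.rpow_one x]
      rw [← Real.rpow_add hx0]; congr 1; ring
    calc R x ≤ C * x ^ g := by rw [hC]; convert h1 using 1; ring
      _ = C * (x ^ (-(1 - g)) * x) := by rw [e]
      _ ≤ C * (ρ / C * x) := by gcongr
      _ = ρ * x := by field_simp

lemma gw_psi (R : ℝ → ℝ) (hmono : Monotone R) (hinf : Tendsto R atTop atTop) (β : ℝ)
    (hβ0 : 0 < β) (hβ1 : β < 1)
    (hRV : ∀ lam > (0 : ℝ), Tendsto (fun x => R (lam * x) / R x) atTop (nhds (lam ^ β)))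
    (δ : ℝ) (hδ0 : 0 < δ) (hδ1 : δ < 1) :
    ∃ ψ : ℝ → ℝ, ConcaveOn ℝ (Set.Ici 0) ψ ∧ MonotoneOn ψ (Set.Ici 0) ∧ (∀ x, 0 ≤ x → 0 ≤ ψ x) ∧
      ∃ Y > (0:ℝ), ∀ x, Y ≤ x → (1 - δ) * R x ≤ ψ x ∧ ψ x ≤ R x := by
  set η := min (β / 2) (δ * (1 - β) / 4) with hη
  have h1β : 0 < 1 - β := by linarith
  have hη0 : 0 < η := lt_min (by linarith) (by positivity)
  have hη1 : η ≤ β / 2 := min_le_left _ _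
  have hη2 : η ≤ δ * (1 - β) / 4 := min_le_right _ _
  set b := β + η with hb
  set g := β - η with hgdef
  have hb1 : b < 1 := by nlinarith
  have hb0 : 0 < b := by linarith
  have hg0 : 0 < g := by linarith
  have hg1 : g < 1 := by linarith
  set q := 1 + δ / 2 with hq
  have hq1 : 1 < q := by linarith
  obtain ⟨Y, hY0, hY⟩ := gw_potter R hmono hinf β hRV b g q (by linarith) (by linarith) hg0 hq1
  have hqp : ∀ t : ℝ, t ≤ 1 → q ^ t ≤ q := fun t ht => by
    calc q ^ t ≤ q ^ (1:ℝ) := Real.rpow_le_rpow_of_exponent_le hq1.le ht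
      _ = q := Real.rpow_one q
  have bern : ∀ l t : ℝ, 0 ≤ l → 0 ≤ t → t ≤ 1 → l ^ t ≤ 1 - t + t * l := fun l t hl ht0 ht1 => by
    have := rpow_one_add_le_one_add_mul_self (s := l - 1) (by linarith) ht0 ht1
    have e : 1 + (l - 1) = l := by ring
    rw [e] at this; linarith
  let A : Set.Ici Y → ℝ → ℝ := fun y x => R y * (1 - b + b * (x / y))
  have hypos : ∀ y : Set.Ici Y, 0 < (y : ℝ) := fun y => lt_of_lt_of_le hY0 y.2
  have hRpos : ∀ y : Set.Ici Y, 0 < R y := fun y => (hY y y.2).1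
  have hA0 : ∀ y x, 0 ≤ x → 0 ≤ A y x := fun y x hx => by
    have h1 := hypos y; have h2 := hRpos y
    have : 0 ≤ b * (x / y) := by positivity
    exact mul_nonneg h2.le (by linarith)
  have : Nonempty (Set.Ici Y) := ⟨⟨Y, Set.mem_Ici.2 le_rfl⟩⟩
  have hbdd : ∀ x, 0 ≤ x → BddBelow (Set.range fun y => A y x) := fun x hx =>
    ⟨0, by rintro _ ⟨y, rfl⟩; exact hA0 y x hx⟩
  have hle : ∀ y x, 0 ≤ x → (⨅ y, A y x) ≤ A y x := fun y x hx => ciInf_le (hbdd x hx) y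
  refine ⟨fun x => ⨅ y, A y x, ⟨convex_Ici 0, ?_⟩, ?_, fun x hx => le_ciInf fun y => hA0 y x hx,
    Y, hY0, fun x hx => ⟨?_, ?_⟩⟩
  · intro x hx z hz s t hs ht hst
    simp only [Set.mem_Ici] at hx hz
    refine le_ciInf fun y => ?_
    simp only [smul_eq_mul]
    have h1 := mul_le_mul_of_nonneg_left (hle y x hx) hs
    have h2 := mul_le_mul_of_nonneg_left (hle y z hz) ht
    have e : s * A y x + t * A y z = A y (s * x + t * z) := by
      simp only [A]
      linear_combination (R y * (1 - b)) * hst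
    linarith
  · intro x hx z hz hxz
    simp only [Set.mem_Ici] at hx hz
    refine le_ciInf fun y => (hle y x hx).trans ?_
    have h1 := hypos y; have h2 := hRpos y
    simp only [A]
    gcongr
  · have hx0 : 0 < x := by linarith
    have hRx : 0 < R x := (hY x hx).1
    refine le_ciInf fun y => ?_
    have hy0 := hypos y; have hRy := hRpos y
    simp only [A]
    rcases le_total (y : ℝ) x with hyx | hyx
    · have h1 := ((hY y y.2).2 (x / y) (by rwa [one_le_div hy0])).1
      rw [div_mul_cancel₀ _ hy0.ne'] at h1
      have h2 := bern (x / y) b (by positivity) hb0.le hb1.le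
      have h3 := hqp b hb1.le
      have h4 : R x ≤ q * (1 - b + b * (x / y)) * R y := by
        refine h1.trans ?_
        have : 0 ≤ (x / y) ^ b := by positivity
        gcongr
      have h5 : (1 - δ) * q ≤ 1 := by rw [hq]; nlinarith
      have h6 : 0 ≤ (1 - b + b * (x / y)) * R y := by
        rw [mul_comm]; exact hA0 y x hx0.le
      calc (1 - δ) * R x ≤ (1 - δ) * (q * (1 - b + b * (x / y)) * R y) :=
            mul_le_mul_of_nonneg_left h4 (by linarith)
        _ = ((1 - δ) * q) * ((1 - b + b * (x / y)) * R y) := by ring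
        _ ≤ 1 * ((1 - b + b * (x / y)) * R y) := mul_le_mul_of_nonneg_right h5 h6
        _ = _ := by ring
    · have h1 := ((hY x hx).2 (y / x) (by rwa [one_le_div hx0])).2
      rw [div_mul_cancel₀ _ hx0.ne'] at h1
      set l := x / (y:ℝ) with hl
      have hl0 : 0 < l := by positivity
      have hl1 : l ≤ 1 := by rw [hl, div_le_one hy0]; exact hyx
      have e1 : (y : ℝ) / x = l⁻¹ := by rw [hl, inv_div]
      rw [e1, Real.inv_rpow hl0.le] at h1
      have h2 := bern l g hl0.le hg0.le hg1.le
      have hlg : 0 < l ^ g := by positivity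
      have h3 : R x ≤ l ^ g * (q * R y) := by
        have h3' := mul_le_mul_of_nonneg_left h1 hlg.le
        rw [← mul_assoc, mul_inv_cancel₀ hlg.ne', one_mul] at h3'
        refine h3'.trans ?_
        have := hqp g hg1.le
        gcongr
      have h4 : (1 - δ / 2) * (1 - g + g * l) ≤ 1 - b + b * l := by
        have : 1 - b + b * l = (1 - g + g * l) - 2 * η * (1 - l) := by rw [hb, hgdef]; ring
        rw [this]
        have h5 : 1 - β ≤ 1 - g + g * l := by nlinarith
        have h6 : 2 * η * (1 - l) ≤ δ / 2 * (1 - β) := by nlinarith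
        nlinarith
      have h7 : (1 - δ) * q ≤ 1 - δ / 2 := by rw [hq]; nlinarith
      have h8 : 0 ≤ 1 - g + g * l := by nlinarith
      calc (1 - δ) * R x ≤ (1 - δ) * (l ^ g * (q * R y)) :=
            mul_le_mul_of_nonneg_left h3 (by linarith)
        _ = ((1 - δ) * q) * (l ^ g * R y) := by ring
        _ ≤ (1 - δ / 2) * (l ^ g * R y) :=
            mul_le_mul_of_nonneg_right h7 (by positivity)
        _ ≤ (1 - δ / 2) * ((1 - g + g * l) * R y) := by
            refine mul_le_mul_of_nonneg_left ?_ (by linarith)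
            exact mul_le_mul_of_nonneg_right h2 hRy.le
        _ = R y * ((1 - δ / 2) * (1 - g + g * l)) := by ring
        _ ≤ _ := mul_le_mul_of_nonneg_left h4 hRy.le
  · have hx0 : 0 < x := by linarith
    refine (hle ⟨x, hx⟩ x hx0.le).trans (le_of_eq ?_)
    simp only [A]
    field_simp
    ring


lemma gw_integrable (ν : Measure ℕ) [IsProbabilityMeasure ν] (m : ℝ) (hm0 : 0 ≤ m)
    (R : ℝ → ℝ) (hR0 : ∀ x, 0 ≤ R x)
    (hν : ∀ x : ℝ, (ν {j : ℕ | x < (j:ℝ)}).toReal = Real.exp (-R x))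
    (hg : ∀ N : ℝ, ∀ᶠ x in atTop, N * Real.log x ≤ R x)
    (ψ : ℝ → ℝ) (hc : ConcaveOn ℝ (Set.Ici 0) ψ) (hmo : MonotoneOn ψ (Set.Ici 0))
    (hp : ∀ x, 0 ≤ x → 0 ≤ ψ x) (Y : ℝ) (hY : 0 < Y) (hψ : ∀ x, Y ≤ x → ψ x ≤ R x)
    (δ : ℝ) (hδ0 : 0 < δ) (hδ1 : δ < 1) :
    Integrable (fun j : ℕ => ((j:ℝ) - m)^2 * Real.exp ((1-δ) * ψ |(j:ℝ) - m|)) ν := by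
  set f : ℕ → ℝ := fun j => ((j:ℝ) - m)^2 * Real.exp ((1-δ) * ψ |(j:ℝ) - m|) with hf
  have hf0 : ∀ j, 0 ≤ f j := fun j => by positivity
  have hsing : ∀ j : ℕ, (ν {j+1}).toReal ≤ Real.exp (-R j) := by
    intro j
    rw [← hν]
    refine ENNReal.toReal_mono (measure_ne_top _ _) (measure_mono ?_)
    intro i hi
    have : i = j + 1 := hi
    subst this
    simp
  have hψj : ∀ x : ℝ, 0 ≤ x → ψ x ≤ R x + ψ Y := by
    intro x hx
    rcases le_total Y x with h | h
    · have := hψ x h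
      have := hp Y hY.le
      linarith
    · have := hmo (Set.mem_Ici.2 hx) (Set.mem_Ici.2 hY.le) h
      have := hR0 x
      linarith
  set B := ψ Y + ψ (1+m) with hB
  have hB0 : 0 ≤ B := add_nonneg (hp _ hY.le) (hp _ (by linarith))
  have hterm : ∀ j : ℕ, f (j+1) * (ν {j+1}).toReal ≤
      Real.exp B * ((j:ℝ)+1+m)^2 * Real.exp (-(δ * R j)) := by
    intro j
    have hj : (0:ℝ) ≤ j := Nat.cast_nonneg j
    have habs : |((j+1:ℕ):ℝ) - m| ≤ (j:ℝ) + (1 + m) := by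
      push_cast
      rw [abs_le]; constructor <;> linarith
    have h1 : ψ |((j+1:ℕ):ℝ) - m| ≤ R j + B := by
      have a1 := hmo (Set.mem_Ici.2 (abs_nonneg _)) (Set.mem_Ici.2 (by linarith)) habs
      have a2 := gw_concave_sub ψ hc j (1+m) hj (by linarith)
      have a3 := hp 0 le_rfl
      have a4 := hψj j hj
      linarith
    have h2 : (((j+1:ℕ):ℝ) - m)^2 ≤ ((j:ℝ)+1+m)^2 := by
      rw [← sq_abs]
      have := abs_nonneg (((j+1:ℕ):ℝ) - m)
      gcongr
      linarith
    have h3 : (1-δ) * ψ |((j+1:ℕ):ℝ) - m| ≤ (1-δ) * R j + B := by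
      have : (1-δ) * ψ |((j+1:ℕ):ℝ) - m| ≤ (1-δ) * (R j + B) :=
        mul_le_mul_of_nonneg_left h1 (by linarith)
      nlinarith
    calc f (j+1) * (ν {j+1}).toReal
        ≤ (((j:ℝ)+1+m)^2 * Real.exp ((1-δ) * R j + B)) * Real.exp (-R j) := by
          apply mul_le_mul _ (hsing j) ENNReal.toReal_nonneg (by positivity)
          simp only [hf]
          gcongr
      _ = Real.exp B * ((j:ℝ)+1+m)^2 * Real.exp (-(δ * R j)) := by
          rw [mul_assoc, ← Real.exp_add, mul_comm (Real.exp B), mul_assoc, ← Real.exp_add]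
          congr 2; ring
  have hsum : Summable (fun j : ℕ => f j * (ν {j}).toReal) := by
    rw [← summable_nat_add_iff 1]
    have hev : ∀ᶠ j : ℕ in atTop, ‖f (j+1) * (ν {j+1}).toReal‖ ≤
        (Real.exp B * (2+m)^2) * (1 / (j:ℝ)^2) := by
      have h4 := (tendsto_natCast_atTop_atTop (R := ℝ)).eventually (hg (4/δ))
      filter_upwards [h4, eventually_ge_atTop 1] with j hj hj1
      have hj1' : (1:ℝ) ≤ j := by exact_mod_cast hj1
      rw [Real.norm_of_nonneg (mul_nonneg (hf0 _) ENNReal.toReal_nonneg)]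
      refine (hterm j).trans ?_
      have h5 : Real.exp (-(δ * R j)) ≤ 1 / (j:ℝ)^4 := by
        have : 4 * Real.log j ≤ δ * R j := by
          have := mul_le_mul_of_nonneg_left hj hδ0.le
          have e : δ * (4/δ * Real.log j) = 4 * Real.log j := by field_simp
          linarith
        calc Real.exp (-(δ * R j)) ≤ Real.exp (-(4 * Real.log j)) := by gcongr
          _ = 1 / (j:ℝ)^4 := by
            rw [Real.exp_neg, one_div]
            congr 1
            have := Real.exp_nat_mul (Real.log j) 4
            push_cast at this
            rw [this, Real.exp_log (by linarith)]
      have h6 : ((j:ℝ)+1+m)^2 ≤ (2+m)^2 * (j:ℝ)^2 := by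
        rw [← mul_pow]
        gcongr
        nlinarith
      calc Real.exp B * ((j:ℝ)+1+m)^2 * Real.exp (-(δ * R j))
          ≤ Real.exp B * ((2+m)^2 * (j:ℝ)^2) * (1 / (j:ℝ)^4) := by gcongr
        _ = _ := by field_simp
    exact Summable.of_norm_bounded_eventually_nat
      ((Real.summable_one_div_nat_pow.2 (by norm_num)).mul_left _) hev
  refine ⟨(measurable_of_countable _).aestronglyMeasurable, ?_⟩
  rw [hasFiniteIntegral_iff_ofReal (Eventually.of_forall hf0), lintegral_countable']
  have : ∀ j : ℕ, ENNReal.ofReal (f j) * ν {j} = ENNReal.ofReal (f j * (ν {j}).toReal) := by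
    intro j
    rw [ENNReal.ofReal_mul (hf0 j), ENNReal.ofReal_toReal (measure_ne_top _ _)]
  simp_rw [this]
  exact hsum.tsum_ofReal_lt_top

lemma gw_arith (δ ρ C Rm Rl p q : ℝ) (hδ0 : 0 < δ) (hδ1 : δ < 1) (h1 : Rl < (ρ + δ) * Rm)
    (h4 : C + p ≤ 4 * δ * Rm) (hRp : 1 ≤ Rm) (h7 : (1 - δ) * Rm ≤ q) (hb : 0 ≤ p)
    (h11 : ρ = 1 - 8 * δ) : C - (1 - δ) * ((1 - δ) * (q - p)) ≤ -Rl := by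
  have h8 : (1-δ)*((1-δ)*((1-δ)*Rm - p)) ≤ (1-δ)*((1-δ)*(q - p)) := by
    have : 0 ≤ 1-δ := by linarith
    gcongr
  have h9 : (1-3*δ)*Rm ≤ (1-δ)^3*Rm := by
    have h : 1-3*δ ≤ (1-δ)^3 := by
      have : 0 ≤ δ^2 * (3 - δ) := mul_nonneg (sq_nonneg _) (by linarith)
      linear_combination this
    exact mul_le_mul_of_nonneg_right h (by linarith)
  have h10 : (1-δ)*((1-δ)*p) ≤ p := by
    have h : (1-δ)*(1-δ) ≤ 1 := by nlinarith
    have := mul_le_mul_of_nonneg_right h hb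
    linarith
  subst h11
  linear_combination h8 + h9 + h10 + h1 + h4


theorem gw_weibull_sandwich
    {Ω : Type*} [MeasurableSpace Ω] (μ : Measure Ω) [IsProbabilityMeasure μ]
    (ξ : ℕ → ℕ → Ω → ℕ)
    (hmeas : ∀ n i, Measurable (ξ n i))
    (hindep : iIndepFun
      (fun p : ℕ × ℕ => ξ p.1 p.2) μ)
    (hident : ∀ n i, Measure.map (ξ n i) μ = Measure.map (ξ 0 0) μ)
    (hint : Integrable (fun ω => (ξ 0 0 ω : ℝ)) μ)
    (m : ℝ) (hm : m = ∫ ω, (ξ 0 0 ω : ℝ) ∂μ) (hm1 : 1 < m)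
    (Z : ℕ → Ω → ℕ)
    (hZ0 : ∀ ω, Z 0 ω = 1)
    (hZrec : ∀ n ω, Z (n + 1) ω = ∑ i ∈ Finset.range (Z n ω), ξ n i ω)
    (W : ℕ → Ω → ℝ) (hW : ∀ n ω, W n ω = (Z n ω : ℝ) / m ^ n)
    (Fbar : ℝ → ℝ) (hFbar : ∀ x, Fbar x = (μ {ω | x < (ξ 0 0 ω : ℝ)}).toReal)
    -- Weibull-type tail: `F̄(x) = exp(-R(x))` with `R` regularly varying of index `β`
    (R : ℝ → ℝ) (hR : ∀ x, Fbar x = Real.exp (-R x))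
    (β : ℝ) (hβ0 : 0 < β)
    (hRV : ∀ lam > (0 : ℝ),
      Tendsto (fun x => R (lam * x) / R x) atTop (nhds (lam ^ β)))
    -- `F` is strong subexponential
    (hSstar : Tendsto
      (fun x => (∫ y in (0:ℝ)..x, Fbar (x - y) * Fbar y) / (2 * m * Fbar x))
      atTop (nhds 1))
    (hβ1 : β < 1) :
    ∀ ε > (0 : ℝ), ∀ ε' > (0 : ℝ), ∃ x₀ : ℝ, ∀ x ≥ x₀, ∀ n : ℕ, 1 ≤ n →
      (1 - ε') * Fbar ((m + ε) * x) ≤ (μ {ω | x < W n ω}).toReal ∧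
        (μ {ω | x < W n ω}).toReal ≤ (1 + ε') * Fbar ((m - ε) * x) := by
  have hm0 : 0 < m := by linarith
  have hFanti : Antitone Fbar := by
    intro x y hxy
    rw [hFbar, hFbar]
    refine ENNReal.toReal_mono (measure_ne_top _ _) (measure_mono ?_)
    intro ω hω
    exact lt_of_le_of_lt hxy hω
  have hRlog : ∀ x, R x = - Real.log (Fbar x) := fun x => by rw [hR, Real.log_exp, neg_neg]
  have hFpos : ∀ x, 0 < Fbar x := fun x => by rw [hR]; exact Real.exp_pos _
  have hmono : Monotone R := by
    intro x y hxy
    have := Real.log_le_log (hFpos y) (hFanti hxy)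
    rw [hRlog, hRlog]; linarith
  have hR0 : ∀ x, 0 ≤ R x := by
    intro x
    have h1 : Fbar x ≤ 1 := by
      rw [hFbar]; exact ENNReal.toReal_le_of_le_ofReal zero_le_one (by simpa using prob_le_one)
    rw [hRlog]
    have := Real.log_nonpos (hFpos x).le h1
    linarith
  have hinf : Tendsto R atTop atTop := by
    have hF0 : Tendsto Fbar atTop (nhds 0) := by
      have hbd : ∀ᶠ x in atTop, Fbar x ≤ m / x := by
        filter_upwards [eventually_gt_atTop (0:ℝ)] with x hx
        rw [le_div_iff₀ hx, mul_comm]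
        have h1 := mul_meas_ge_le_integral_of_nonneg (μ := μ)
          (f := fun ω => (ξ 0 0 ω : ℝ)) (Eventually.of_forall fun ω => Nat.cast_nonneg _) hint x
        rw [← hm] at h1
        refine le_trans ?_ h1
        rw [hFbar]
        refine mul_le_mul_of_nonneg_left ?_ hx.le
        refine ENNReal.toReal_mono (measure_ne_top _ _) (measure_mono ?_)
        intro ω hω
        exact (show x < (ξ 0 0 ω : ℝ) from hω).le
      exact squeeze_zero' (Eventually.of_forall fun x => (hFpos x).le) hbd
        (tendsto_const_nhds.div_atTop tendsto_id)
    have h2 : Tendsto Fbar atTop (nhdsWithin 0 (Set.Ioi 0)) :=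
      tendsto_nhdsWithin_iff.2 ⟨hF0, Eventually.of_forall fun x => hFpos x⟩
    have h3 := tendsto_neg_atBot_atTop.comp (Real.tendsto_log_nhdsGT_zero.comp h2)
    refine h3.congr fun x => ?_
    simp [hRlog]
  obtain ⟨hZm, hM⟩ := gw_markov μ ξ hmeas hindep hident Z hZ0 hZrec
  set ν := Measure.map (ξ 0 0) μ with hνdef
  have : IsProbabilityMeasure ν := Measure.isProbabilityMeasure_map (hmeas 0 0).aemeasurable
  have hcast : Measurable (fun j : ℕ => (j:ℝ)) := measurable_of_countable _
  have hνint : Integrable (fun j : ℕ => (j:ℝ)) ν := by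
    rw [hνdef, integrable_map_measure hcast.aestronglyMeasurable (hmeas 0 0).aemeasurable]
    exact hint
  have hνm : m = ∫ j, (j:ℝ) ∂ν := by
    rw [hνdef, integral_map (hmeas 0 0).aemeasurable hcast.aestronglyMeasurable]
    exact hm
  have hνtail : ∀ x : ℝ, (ν {j : ℕ | x < (j:ℝ)}).toReal = Real.exp (-R x) := by
    intro x
    rw [hνdef, Measure.map_apply (hmeas 0 0) (MeasurableSet.of_discrete), ← hR, hFbar]
    rfl
  obtain ⟨hg1, hg2⟩ := gw_growth R hmono hinf β hβ0 hβ1 hRV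
  intro ε hε ε' hε'
  set ε₁ := min ε (m/2) with hε₁
  have hε₁0 : 0 < ε₁ := lt_min hε (by linarith)
  have hε₁m : ε₁ ≤ m/2 := min_le_right _ _
  have hε₁e : ε₁ ≤ ε := min_le_left _ _
  set lam := (m - ε₁)/m with hlam
  have hlam0 : 0 < lam := div_pos (by linarith) hm0
  have hlam1 : lam < 1 := by rw [hlam, div_lt_one hm0]; linarith
  set ρ := lam ^ β with hρ
  have hρ0 : 0 < ρ := Real.rpow_pos_of_pos hlam0 _
  have hρ1 : ρ < 1 := Real.rpow_lt_one hlam0.le hlam1 hβ0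
  set δ := (1-ρ)/8 with hδ
  have hδ0 : 0 < δ := by rw [hδ]; linarith
  have hδ1 : δ < 1 := by rw [hδ]; linarith
  obtain ⟨ψ, hc, hmo, hp, Y, hY0, hY⟩ := gw_psi R hmono hinf β hβ0 hβ1 hRV δ hδ0 hδ1
  have hI := gw_integrable ν m hm0.le R hR0 hνtail hg1 ψ hc hmo hp Y hY0 (fun x hx => (hY x hx).2)
    δ hδ0 hδ1
  have hV : Integrable (fun j : ℕ => ((j:ℝ) - m)^2) ν := by
    refine hI.mono (measurable_of_countable _).aestronglyMeasurable (Eventually.of_forall fun j => ?_)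
    rw [Real.norm_of_nonneg (sq_nonneg _), Real.norm_of_nonneg (by positivity)]
    refine le_mul_of_one_le_right (sq_nonneg _) (Real.one_le_exp ?_)
    exact mul_nonneg (by linarith) (hp _ (abs_nonneg _))
  -- upper bound
  set K := ∫ j, ((j : ℝ) - m) ^ 2 * Real.exp ((1-δ) * ψ |(j : ℝ) - m|) ∂ν with hKdef
  have hK0 : 0 ≤ K := integral_nonneg fun j => by positivity
  have hgm : 0 < 1 - 1/m := by rw [sub_pos, div_lt_one hm0]; exact hm1
  set r := δ * (1 - 1/m) / (K+1) with hr
  have hr0 : 0 < r := by positivity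
  obtain ⟨b, hbR, hbY⟩ := ((hg2 r hr0).and (eventually_ge_atTop Y)).exists
  have hb0 : 0 < b := lt_of_lt_of_le hY0 hbY
  have hψb : ψ b / b ≤ r := by
    rw [div_le_iff₀ hb0]; exact (hY b hbY).2.trans hbR
  obtain ⟨hφ, hφle⟩ := gw_phi_of_psi ψ hc hmo hp b (1-δ) hb0 (by linarith) (by linarith)
  have hle : ∀ j : ℕ, ((j : ℝ) - m) ^ 2 * Real.exp ((1-δ) * (ψ (|(j : ℝ) - m| + b) - ψ b)) ≤
      ((j : ℝ) - m) ^ 2 * Real.exp ((1-δ) * ψ |(j : ℝ) - m|) := by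
    intro j
    have := hφle _ (abs_nonneg ((j:ℝ) - m))
    gcongr
  have hKint : Integrable (fun j : ℕ => ((j : ℝ) - m) ^ 2 *
      Real.exp ((1-δ) * (ψ (|(j : ℝ) - m| + b) - ψ b))) ν := by
    refine hI.mono (measurable_of_countable _).aestronglyMeasurable (Eventually.of_forall fun j => ?_)
    rw [Real.norm_of_nonneg (by positivity), Real.norm_of_nonneg (by positivity)]
    exact hle j
  obtain ⟨C, hC⟩ := gw_upper μ ν m hm1 hνint hνm Z hZ0 hZm hM _ _ hφ K hKint
    (integral_mono hKint hI hle) δ hδ1.le (by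
      calc K * (ψ b / b) ≤ (K+1) * r := by
            apply mul_le_mul (by linarith) hψb _ (by linarith)
            exact div_nonneg (hp _ hb0.le) hb0.le
        _ = δ * (1 - 1/m) := by rw [hr]; field_simp)
  have hup : ∀ᶠ x in atTop, ∀ n : ℕ,
      (μ {ω | x < (Z n ω : ℝ) / m ^ n}).toReal ≤ Fbar ((m - ε₁) * x) := by
    have hmx : Tendsto (fun x : ℝ => m * x) atTop atTop := tendsto_id.const_mul_atTop hm0
    have e1 := hmx.eventually ((hRV lam hlam0).eventually_lt_const
      (show lam ^ β < ρ + δ by linarith))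
    have e2 := hmx.eventually (hinf.eventually_ge_atTop (max 1 ((C + ψ b)/(4*δ))))
    have e3 := hmx.eventually (eventually_ge_atTop Y)
    filter_upwards [e1, e2, e3, eventually_ge_atTop 0] with x h1 h2 h3 hx n
    refine (hC n x hx).trans ?_
    rw [hR]
    apply Real.exp_le_exp.2
    have hRp : 1 ≤ R (m*x) := (le_max_left _ _).trans h2
    have h4 : C + ψ b ≤ 4*δ*R (m*x) := by
      have := (le_max_right _ _).trans h2
      rw [div_le_iff₀ (by linarith)] at this
      linarith
    rw [div_lt_iff₀ (by linarith)] at h1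
    have h5 : lam * (m*x) = (m - ε₁)*x := by rw [hlam]; field_simp
    rw [h5] at h1
    have hmx0 : 0 ≤ m * x := by positivity
    have h6 : ψ (m*x) ≤ ψ (m*x + b) :=
      hmo (Set.mem_Ici.2 hmx0) (Set.mem_Ici.2 (by linarith)) (by linarith)
    have h7 := (hY _ h3).1
    have hb' := hp b hb0.le
    have h11 : ρ = 1 - 8*δ := by rw [hδ]; ring
    exact gw_arith δ ρ C _ _ _ _ hδ0 hδ1 h1 h4 hRp (h7.trans h6) hb' h11
  -- lower bound
  set κ := min 1 (ε/(2*m)) with hκ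
  have hκ0 : 0 < κ := lt_min one_pos (by positivity)
  have hκ2 : κ ≤ ε/(2*m) := min_le_right _ _
  obtain ⟨θ, hθ0, hlow⟩ := gw_lower μ ν m hm1 hνint hνm Z hZm hM hV κ hκ0 (min_le_left _ _)
  have hexp : ∀ᶠ x in atTop, Real.exp (-(θ*(ε/(2*m))*x)) < ε' := by
    have h1 : Tendsto (fun x : ℝ => θ*(ε/(2*m))*x) atTop atTop :=
      tendsto_id.const_mul_atTop (by positivity)
    exact (Real.tendsto_exp_neg_atTop_nhds_zero.comp h1).eventually_lt_const hε'
  have hZ1 : ∀ ω, Z 1 ω = ξ 0 0 ω := by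
    intro ω
    have := hZrec 0 ω
    rw [hZ0] at this
    simpa using this
  obtain ⟨x₀, hx₀⟩ := eventually_atTop.1 ((hup.and hexp).and (eventually_ge_atTop (0:ℝ)))
  refine ⟨x₀, fun x hx n hn => ?_⟩
  obtain ⟨⟨hu, he⟩, hx0⟩ := hx₀ x hx
  simp only [hW]
  constructor
  · have h1 := hlow n hn x ((m+ε)*x) hx0 (by positivity)
    simp only [hZ1] at h1
    rw [← hFbar] at h1
    refine le_trans ?_ h1
    refine mul_le_mul_of_nonneg_right ?_ (hFpos _).le
    have h2 : θ * ((1+κ)*x - (m+ε)*x/m) ≤ -(θ*(ε/(2*m))*x) := by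
      have e : (m+ε)*x/m = x + 2*(ε/(2*m))*x := by field_simp
      rw [e]
      have : κ*x ≤ ε/(2*m)*x := mul_le_mul_of_nonneg_right hκ2 hx0
      have := mul_le_mul_of_nonneg_left this hθ0.le
      nlinarith
    have := Real.exp_le_exp.2 h2
    linarith
  · refine (hu n).trans ?_
    have h1 : Fbar ((m-ε₁)*x) ≤ Fbar ((m-ε)*x) :=
      hFanti (mul_le_mul_of_nonneg_right (by linarith) hx0)
    have := hFpos ((m-ε)*x)
    nlinarith
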